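/- arXiv:1501.05094 — 7 statements merged into one kernel-verified Lean document; each statement's English description precedes it below -/
import Mathlib

section
/- For ε ∈ {1,−1} and r ∈ {1,2} set S^{εr} = {a + εδʳ : a ∈ A₄*, (a+εδʳ | a+εδʳ) = 2/5}. Define β₁ = (1/5)(0,−1,−2,2,1), β₂ = (1/5)(2,1,0,−1,−2), β₃ = (1/5)(−1,−2,2,1,0), β₄ = (1/5)(1,0,−1,−2,2), β₀ = (1/5)(−2,2,1,0,−1). Then S¹ = {βᵢ : i = 0,1,2,3,4}, S² = {βᵢ+βᵢ₊₁ : i = 0,1,2,3,4}, S^{−2} = {βᵢ+βᵢ₊₁+βᵢ₊₂ : i = 0,1,2,3,4}, and S^{−1} = {βᵢ+βᵢ₊₁+βᵢ₊₂+βᵢ₊₃ : i = 0,1,2,3,4}, where all indices are read modulo 5. In particular each of the four sets S^{εr} has exactly 5 elements. -/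
/-- The standard inner product on ℝ⁵. -/
def ip5 (x y : Fin 5 → ℝ) : ℝ := ∑ i, x i * y i

/-- The A₄ root lattice: integer vectors in ℝ⁵ with coordinate sum 0. -/
def A4lat : Set (Fin 5 → ℝ) := {a | (∀ i, ∃ n : ℤ, a i = n) ∧ (∑ i, a i) = 0}

/-- The dual lattice A₄* inside the sum-zero hyperplane. -/
def A4dual : Set (Fin 5 → ℝ) :=
  {x | (∑ i, x i) = 0 ∧ ∀ a ∈ A4lat, ∃ n : ℤ, ip5 x a = n}

noncomputable def δ1 : Fin 5 → ℝ := (1 / 5 : ℝ) • ![2, 1, 0, -1, -2]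

noncomputable def δ2 : Fin 5 → ℝ := (1 / 5 : ℝ) • ![-1, 2, 0, -2, 1]

/-- `S^{εr} = {a + εδʳ : a ∈ A₄*, |a + εδʳ|² = 2/5}`, as a function of `d = εδʳ`. -/
def Sset (d : Fin 5 → ℝ) : Set (Fin 5 → ℝ) :=
  {y | ∃ a ∈ A4dual, y = a + d ∧ ip5 y y = 2 / 5}

/-- The vectors β₀, β₁, β₂, β₃, β₄, indexed cyclically by ZMod 5. -/
noncomputable def β : ZMod 5 → Fin 5 → ℝ := fun i =>
  if i = 0 then (1 / 5 : ℝ) • ![-2, 2, 1, 0, -1]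
  else if i = 1 then (1 / 5 : ℝ) • ![0, -1, -2, 2, 1]
  else if i = 2 then (1 / 5 : ℝ) • ![2, 1, 0, -1, -2]
  else if i = 3 then (1 / 5 : ℝ) • ![-1, -2, 2, 1, 0]
  else (1 / 5 : ℝ) • ![1, 0, -1, -2, 2]

/-- The vector of least absolute residues of `c + v` modulo 5, divided by 5. -/
noncomputable def residueVec (v : Fin 5 → ZMod 5) (c : ZMod 5) : Fin 5 → ℝ :=
  fun i => ((c + v i).valMinAbs : ℝ) / 5

theorem residueVec_injective (v : Fin 5 → ZMod 5) : Function.Injective (residueVec v) := by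
  intro c c' h
  have h0 := congrFun h 0
  simp only [residueVec] at h0
  have h1 : (c + v 0).valMinAbs = (c' + v 0).valMinAbs := by
    have : ((c + v 0).valMinAbs : ℝ) = (c' + v 0).valMinAbs := by linarith
    exact_mod_cast this
  exact add_right_cancel (ZMod.injective_valMinAbs h1)

theorem sum_comp_add_bijective {M : Type*} [AddCommMonoid M] {v : Fin 5 → ZMod 5}
    (hv : Function.Bijective v) (c : ZMod 5) (f : ZMod 5 → M) : ∑ i, f (c + v i) = ∑ z, f z :=
  ((Equiv.addLeft c).bijective.comp hv).sum_comp f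

theorem sum_valMinAbs_add {v : Fin 5 → ZMod 5} (hv : Function.Bijective v) (c : ZMod 5) :
    ∑ i, (c + v i).valMinAbs = 0 := by
  rw [sum_comp_add_bijective hv c ZMod.valMinAbs]
  decide

theorem sum_valMinAbs_add_sq {v : Fin 5 → ZMod 5} (hv : Function.Bijective v) (c : ZMod 5) :
    ∑ i, (c + v i).valMinAbs ^ 2 = 10 := by
  rw [sum_comp_add_bijective hv c (fun z => z.valMinAbs ^ 2)]
  decide

theorem sum_residueVec {v : Fin 5 → ZMod 5} (hv : Function.Bijective v) (c : ZMod 5) :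
    ∑ i, residueVec v c i = 0 := by
  have h : ∑ i, ((c + v i).valMinAbs : ℝ) = 0 := by
    exact_mod_cast sum_valMinAbs_add hv c
  simp only [residueVec, ← Finset.sum_div, h, zero_div]

theorem ip5_residueVec_self {v : Fin 5 → ZMod 5} (hv : Function.Bijective v) (c : ZMod 5) :
    ip5 (residueVec v c) (residueVec v c) = 2 / 5 := by
  have h : ∑ i, ((c + v i).valMinAbs : ℝ) ^ 2 = 10 := by
    exact_mod_cast sum_valMinAbs_add_sq hv c
  calc ip5 (residueVec v c) (residueVec v c)
      = (∑ i, ((c + v i).valMinAbs : ℝ) ^ 2) / 25 := by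
        rw [ip5, Finset.sum_div]
        exact Finset.sum_congr rfl fun i _ => by simp only [residueVec]; ring
    _ = 2 / 5 := by rw [h]; norm_num

theorem residueVec_sub_mem_A4dual {v : Fin 5 → ZMod 5} (hv : Function.Bijective v)
    (c : ZMod 5) : residueVec v c - residueVec v 0 ∈ A4dual := by
  refine ⟨by simp [Finset.sum_sub_distrib, sum_residueVec hv], ?_⟩
  rintro b ⟨hb, hb0⟩
  choose m hm using hb
  have hk (i : Fin 5) : ∃ k : ℤ, (c + v i).valMinAbs - (v i).valMinAbs = c.valMinAbs + 5 * k := by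
    have h : (5 : ℤ) ∣ (c + v i).valMinAbs - (v i).valMinAbs - c.valMinAbs := by
      rw [← Nat.cast_ofNat, ← ZMod.intCast_zmod_eq_zero_iff_dvd _ 5]
      push_cast [ZMod.coe_valMinAbs]
      ring
    obtain ⟨k, hk⟩ := h
    exact ⟨k, by linarith⟩
  choose k hk using hk
  refine ⟨∑ i, k i * m i, ?_⟩
  have hterm (i : Fin 5) : (residueVec v c - residueVec v 0) i * b i
      = (c.valMinAbs : ℝ) / 5 * b i + k i * m i := by
    have h : ((c + v i).valMinAbs : ℝ) - (v i).valMinAbs = c.valMinAbs + 5 * k i := by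
      exact_mod_cast hk i
    simp only [residueVec, Pi.sub_apply, zero_add, ← sub_div, h, ← hm]
    ring
  simp only [ip5, hterm, Finset.sum_add_distrib, ← Finset.mul_sum, hb0]
  push_cast
  ring

/-- Coordinates of a vector of `A₄*` differ by integers. -/
theorem exists_intCast_eq_sub_of_mem_A4dual {a : Fin 5 → ℝ} (ha : a ∈ A4dual) (i j : Fin 5) :
    ∃ n : ℤ, a i - a j = n := by
  obtain ⟨n, hn⟩ := ha.2 (Pi.single i 1 - Pi.single j 1) ⟨fun l =>
    ⟨(Pi.single i 1 - Pi.single j 1 : Fin 5 → ℤ) l, by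
      simp [Pi.single_apply]⟩, by simp [Finset.sum_sub_distrib]⟩
  exact ⟨n, by simpa [ip5, mul_sub, Finset.sum_sub_distrib, Pi.single_apply] using hn⟩

theorem exists_eq_valMinAbs_add_five_mul (w : ℤ) :
    ∃ k : ℤ, w = (w : ZMod 5).valMinAbs + 5 * k := by
  have h : (5 : ℤ) ∣ w - (w : ZMod 5).valMinAbs := by
    rw [← Nat.cast_ofNat, ← ZMod.intCast_zmod_eq_zero_iff_dvd _ 5]
    push_cast [ZMod.coe_valMinAbs]
    ring
  obtain ⟨k, hk⟩ := h
  exact ⟨k, by linarith⟩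

theorem valMinAbs_five_mem_Icc (z : ZMod 5) : z.valMinAbs ∈ Set.Icc (-2 : ℤ) 2 := by
  revert z
  decide

theorem valMinAbs_sq_le (w : ℤ) : (w : ZMod 5).valMinAbs ^ 2 ≤ w ^ 2 := by
  obtain ⟨k, hk⟩ := exists_eq_valMinAbs_add_five_mul w
  obtain ⟨h1, h2⟩ := valMinAbs_five_mem_Icc (w : ZMod 5)
  generalize (w : ZMod 5).valMinAbs = b at *
  subst hk
  rcases lt_trichotomy k 0 with h | rfl | h
  · nlinarith
  · simp
  · nlinarith

theorem eq_valMinAbs_of_sq_eq {w : ℤ} (h : (w : ZMod 5).valMinAbs ^ 2 = w ^ 2) :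
    w = (w : ZMod 5).valMinAbs := by
  obtain ⟨k, hk⟩ := exists_eq_valMinAbs_add_five_mul w
  obtain ⟨h1, h2⟩ := valMinAbs_five_mem_Icc (w : ZMod 5)
  rcases sq_eq_sq_iff_eq_or_eq_neg.mp h with h | h <;> omega

/-- The least absolute residues are the only integers in their classes whose squares
sum to at most 10. -/
theorem eq_valMinAbs_of_sum_sq {v : Fin 5 → ZMod 5} (hv : Function.Bijective v) {c : ZMod 5}
    {w : Fin 5 → ℤ} (hw : ∀ i, (w i : ZMod 5) = c + v i) (hs : ∑ i, w i ^ 2 = 10) (i : Fin 5) :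
    w i = (c + v i).valMinAbs := by
  have hle (i : Fin 5) (_ : i ∈ Finset.univ) : (c + v i).valMinAbs ^ 2 ≤ w i ^ 2 :=
    hw i ▸ valMinAbs_sq_le (w i)
  have h := (Finset.sum_eq_sum_iff_of_le hle).mp ((sum_valMinAbs_add_sq hv c).trans hs.symm) i
    (Finset.mem_univ i)
  rw [← hw i] at h ⊢
  exact eq_valMinAbs_of_sq_eq h

theorem Sset_residueVec_zero {v : Fin 5 → ZMod 5} (hv : Function.Bijective v) :
    Sset (residueVec v 0) = Set.range (residueVec v) := by
  ext y
  constructor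
  · rintro ⟨a, ha, rfl, hn⟩
    choose n hd using fun i => exists_intCast_eq_sub_of_mem_A4dual ha i 0
    have ha0 : 5 * a 0 = -∑ i, (n i : ℝ) := by
      simp only [← hd, Finset.sum_sub_distrib, ha.1]
      simp
    set w : Fin 5 → ℤ := fun i => 5 * n i - ∑ j, n j + (v i).valMinAbs with hw
    have hy (i : Fin 5) : (a + residueVec v 0) i = w i / 5 := by
      simp only [hw, Pi.add_apply, residueVec, zero_add]
      push_cast
      linarith [hd i]
    have hmod (i : Fin 5) : (w i : ZMod 5) = ((-∑ j, n j : ℤ) : ZMod 5) + v i := by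
      have h5 : (5 : ZMod 5) = 0 := by decide
      simp only [hw]
      push_cast [ZMod.coe_valMinAbs, h5]
      ring
    have hs : ∑ i, w i ^ 2 = 10 := by
      have h : ∑ i, (w i : ℝ) ^ 2 = 10 := by
        calc ∑ i, (w i : ℝ) ^ 2 = 25 * ip5 (a + residueVec v 0) (a + residueVec v 0) := by
              rw [ip5, Finset.mul_sum]
              exact Finset.sum_congr rfl fun i _ => by rw [hy]; ring
          _ = 10 := by rw [hn]; norm_num
      exact_mod_cast h
    refine ⟨((-∑ j, n j : ℤ) : ZMod 5), funext fun i => ?_⟩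
    rw [hy, eq_valMinAbs_of_sum_sq hv hmod hs i, residueVec]
  · rintro ⟨c, rfl⟩
    exact ⟨_, residueVec_sub_mem_A4dual hv c, by simp, ip5_residueVec_self hv c⟩

theorem ncard_range_residueVec (v : Fin 5 → ZMod 5) : (Set.range (residueVec v)).ncard = 5 := by
  rw [← Set.image_univ, Set.ncard_image_of_injective _ (residueVec_injective v), Set.ncard_univ,
    Nat.card_zmod]

theorem range_residueVec_eq {v : Fin 5 → ZMod 5} {f : ZMod 5 → Fin 5 → ℝ} {σ : ZMod 5 → ZMod 5}
    (hσ : Function.Surjective σ) (hf : ∀ i j, f i j = residueVec v (σ i) j) :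
    Set.range (residueVec v) = {x | ∃ i, x = f i} := by
  have h : f = residueVec v ∘ σ := funext fun i => funext fun j => hf i j
  rw [← hσ.range_comp, ← h]
  ext x
  simp [eq_comm]

theorem β_apply (i : ZMod 5) (j : Fin 5) :
    β i j = ((2 * i + 3 - (j : ℕ) : ZMod 5).valMinAbs : ℝ) / 5 := by
  have h : ∀ (i : ZMod 5) (j : Fin 5), (2 * i + 3 - (j : ℕ) : ZMod 5).valMinAbs =
      (if i = 0 then ![-2, 2, 1, 0, -1] else if i = 1 then ![0, -1, -2, 2, 1]
        else if i = 2 then ![2, 1, 0, -1, -2] else if i = 3 then ![-1, -2, 2, 1, 0]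
        else ![1, 0, -1, -2, 2] : Fin 5 → ℤ) j := by decide
  rw [h]
  unfold β
  split_ifs <;> fin_cases j <;> simp <;> ring

theorem stmt_7 :
    Sset δ1 = {x | ∃ i : ZMod 5, x = β i} ∧
    Sset δ2 = {x | ∃ i : ZMod 5, x = β i + β (i + 1)} ∧
    Sset (-δ2) = {x | ∃ i : ZMod 5, x = β i + β (i + 1) + β (i + 2)} ∧
    Sset (-δ1) = {x | ∃ i : ZMod 5, x = β i + β (i + 1) + β (i + 2) + β (i + 3)} ∧
    (Sset δ1).ncard = 5 ∧ (Sset δ2).ncard = 5 ∧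
    (Sset (-δ2)).ncard = 5 ∧ (Sset (-δ1)).ncard = 5 := by
  have h1 : δ1 = residueVec ![2, 1, 0, -1, -2] 0 := by
    have h : ∀ j, (0 + (![2, 1, 0, -1, -2] : Fin 5 → ZMod 5) j).valMinAbs =
      (![2, 1, 0, -1, -2] : Fin 5 → ℤ) j := by decide
    ext j
    rw [residueVec, h]
    fin_cases j <;> simp [δ1] <;> ring
  have h2 : δ2 = residueVec ![-1, 2, 0, -2, 1] 0 := by
    have h : ∀ j, (0 + (![-1, 2, 0, -2, 1] : Fin 5 → ZMod 5) j).valMinAbs =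
      (![-1, 2, 0, -2, 1] : Fin 5 → ℤ) j := by decide
    ext j
    rw [residueVec, h]
    fin_cases j <;> simp [δ2] <;> ring
  have h3 : -δ2 = residueVec ![1, -2, 0, 2, -1] 0 := by
    have h : ∀ j, (0 + (![1, -2, 0, 2, -1] : Fin 5 → ZMod 5) j).valMinAbs =
      (![1, -2, 0, 2, -1] : Fin 5 → ℤ) j := by decide
    ext j
    rw [residueVec, h]
    fin_cases j <;> simp [δ2] <;> ring
  have h4 : -δ1 = residueVec ![-2, -1, 0, 1, 2] 0 := by
    have h : ∀ j, (0 + (![-2, -1, 0, 1, 2] : Fin 5 → ZMod 5) j).valMinAbs =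
      (![-2, -1, 0, 1, 2] : Fin 5 → ℤ) j := by decide
    ext j
    rw [residueVec, h]
    fin_cases j <;> simp [δ1] <;> ring
  rw [h3, h4, h1, h2, Sset_residueVec_zero (by decide), Sset_residueVec_zero (by decide),
    Sset_residueVec_zero (by decide), Sset_residueVec_zero (by decide)]
  refine ⟨range_residueVec_eq (σ := fun i => 2 * i + 1) (by decide) fun i j => ?_,
    range_residueVec_eq (σ := fun i => 4 * i + 4) (by decide) fun i j => ?_,
    range_residueVec_eq (σ := fun i => i - 1) (by decide) fun i j => ?_,
    range_residueVec_eq (σ := fun i => 3 * i + 1) (by decide) fun i j => ?_,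
    ncard_range_residueVec _, ncard_range_residueVec _, ncard_range_residueVec _,
    ncard_range_residueVec _⟩ <;>
  simp only [Pi.add_apply, β_apply, residueVec, ← add_div] <;>
  congr 1 <;>
  norm_cast <;>
  revert i j <;>
  decide
end

section
/- Every nonzero vector x ∈ A₄* satisfies (x|x) ≥ 4/5, and this bound is attained: the vector (1/5)(4,−1,−1,−1,−1) ∈ A₄* has squared norm 4/5. In other words, the minimal squared norm of the dual lattice A₄* is 4/5. -/
theorem sub_single_mem_A4lat (i j : Fin 5) :
    (Pi.single i 1 - Pi.single j 1 : Fin 5 → ℝ) ∈ A4lat := by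
  refine ⟨fun k => ⟨(Pi.single i 1 - Pi.single j 1 : Fin 5 → ℤ) k, ?_⟩, ?_⟩
  · simp [Pi.single_apply]
  · simp [Finset.sum_sub_distrib]

/-- Coordinates of a vector of the dual lattice differ by integers. -/
theorem exists_int_sub_eq_of_mem_A4dual {x : Fin 5 → ℝ} (hx : x ∈ A4dual) (i j : Fin 5) :
    ∃ n : ℤ, x i - x j = n := by
  obtain ⟨n, hn⟩ := hx.2 _ (sub_single_mem_A4lat i j)
  refine ⟨n, ?_⟩
  rw [← hn]
  simp [ip5, mul_sub, Finset.sum_sub_distrib, Pi.single_apply]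

theorem one_le_sq_sub_of_mem_A4dual {x : Fin 5 → ℝ} (hx : x ∈ A4dual) {i j : Fin 5}
    (hij : x i ≠ x j) : 1 ≤ (x i - x j) ^ 2 := by
  obtain ⟨n, hn⟩ := exists_int_sub_eq_of_mem_A4dual hx i j
  have h0 : n ≠ 0 := by
    rintro rfl
    exact hij (sub_eq_zero.mp (by simpa using hn))
  rw [hn]
  exact_mod_cast (one_le_sq_iff_one_le_abs n).mpr (Int.one_le_abs h0)

theorem one_le_add_sq_sub_of_mem_A4dual {x : Fin 5 → ℝ} (hx : x ∈ A4dual) {i j : Fin 5}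
    (hij : x i ≠ x j) (k : Fin 5) : 1 ≤ (x k - x i) ^ 2 + (x k - x j) ^ 2 := by
  by_cases hki : x k = x i
  · have := one_le_sq_sub_of_mem_A4dual hx (hki ▸ hij : x k ≠ x j)
    nlinarith [sq_nonneg (x k - x i)]
  · have := one_le_sq_sub_of_mem_A4dual hx hki
    nlinarith [sq_nonneg (x k - x j)]

theorem four_fifths_le_ip5_self {x : Fin 5 → ℝ} (hx : x ∈ A4dual) (h0 : x ≠ 0) :
    4 / 5 ≤ ip5 x x := by
  have hsum := hx.1
  obtain ⟨i, hi⟩ : ∃ i, x i ≠ x 0 := by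
    by_contra! h
    have hz : x 0 = 0 := by
      simp only [h, Finset.sum_const, Finset.card_univ, Fintype.card_fin, nsmul_eq_mul] at hsum
      simpa using hsum
    exact h0 (funext fun i => (h i).trans hz)
  have hpair := one_le_sq_sub_of_mem_A4dual hx hi
  have htri := one_le_add_sq_sub_of_mem_A4dual hx hi
  have h1 := htri 1
  have h2 := htri 2
  have h3 := htri 3
  have h4 := htri 4
  simp only [Fin.sum_univ_five] at hsum
  have hnorm : 5 * ip5 x x =
      (x 1 - x 0) ^ 2 + (x 2 - x 0) ^ 2 + (x 3 - x 0) ^ 2 + (x 4 - x 0) ^ 2 +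
      (x 1 - x 2) ^ 2 + (x 1 - x 3) ^ 2 + (x 1 - x 4) ^ 2 + (x 2 - x 3) ^ 2 +
      (x 2 - x 4) ^ 2 + (x 3 - x 4) ^ 2 := by
    simp only [ip5, Fin.sum_univ_five]
    linear_combination (x 0 + x 1 + x 2 + x 3 + x 4) * hsum
  have hsq := fun j k => sq_nonneg (x j - x k)
  fin_cases i
  · exact absurd rfl hi
  all_goals
    simp only [Fin.mk_one, Fin.reduceFinMk] at hpair h1 h2 h3 h4
    nlinarith [hsq 1 2, hsq 1 3, hsq 1 4, hsq 2 3, hsq 2 4, hsq 3 4]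

theorem stmt_9 :
    (∀ x ∈ A4dual, x ≠ 0 → ip5 x x ≥ 4 / 5) ∧
    ((1 / 5 : ℝ) • ![4, -1, -1, -1, -1] : Fin 5 → ℝ) ∈ A4dual ∧
    ip5 ((1 / 5 : ℝ) • ![4, -1, -1, -1, -1]) ((1 / 5 : ℝ) • ![4, -1, -1, -1, -1]) = 4 / 5 := by
  refine ⟨fun x hx h0 => four_fifths_le_ip5_self hx h0, ⟨?_, ?_⟩, ?_⟩
  · simp [Fin.sum_univ_five]
    norm_num
  · rintro a ⟨hint, hsum⟩
    obtain ⟨n, hn⟩ := hint 0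
    refine ⟨n, ?_⟩
    rw [← hn]
    simp only [Fin.sum_univ_five] at hsum
    simp [ip5, Fin.sum_univ_five]
    linarith
  · simp [ip5, Fin.sum_univ_five]
    norm_num
end

section
/- P₀(N) = {(a, b/5, b/5, b/5, b/5, b/5) : a ∈ A₄*, b ∈ A₄}, i.e., the image of the Niemeier lattice N under the orthogonal projection P₀ onto the fixed subspace of τ₀ equals the set of vectors (1/5)(5a, b, b, b, b, b) with a ∈ A₄* and b ∈ A₄. -/
noncomputable def w1 : Fin 5 → ℝ := (1 / 5 : ℝ) • ![4, -1, -1, -1, -1]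

noncomputable def w4 : Fin 5 → ℝ := (1 / 5 : ℝ) • ![1, 1, 1, 1, -4]

/-- The four glue vectors, corresponding to the glue code rows
`(1,0,1,4,4,1)`, `(1,1,0,1,4,4)`, `(1,4,1,0,1,4)`, `(1,4,4,1,0,1)`. -/
noncomputable def glue : Set (Fin 6 → Fin 5 → ℝ) :=
  {![w1, 0, w1, w4, w4, w1], ![w1, w1, 0, w1, w4, w4],
   ![w1, w4, w1, 0, w1, w4], ![w1, w4, w4, w1, 0, w1]}

/-- The block-diagonal copy of A₄⁶ in ℝ³⁰ = (ℝ⁵)⁶. -/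
def A4six : Set (Fin 6 → Fin 5 → ℝ) := {x | ∀ k, x k ∈ A4lat}

/-- The Niemeier lattice with root lattice A₄⁶, generated by A₄⁶ and the glue vectors. -/
noncomputable def NLat : AddSubgroup (Fin 6 → Fin 5 → ℝ) := AddSubgroup.closure (A4six ∪ glue)

/-- The isometry τ₀ cyclically permuting the last five ℝ⁵-blocks:
`(x₁,x₂,x₃,x₄,x₅,x₆) ↦ (x₁,x₆,x₂,x₃,x₄,x₅)`. -/
def τ : (Fin 6 → Fin 5 → ℝ) → Fin 6 → Fin 5 → ℝ := fun x => ![x 0, x 5, x 1, x 2, x 3, x 4]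

/-- The orthogonal projection onto the fixed subspace of τ₀. -/
noncomputable def P0 : (Fin 6 → Fin 5 → ℝ) → Fin 6 → Fin 5 → ℝ := fun x =>
  let m := (1 / 5 : ℝ) • (x 1 + x 2 + x 3 + x 4 + x 5)
  ![x 0, m, m, m, m, m]

/-- The root lattice A₄ as a subgroup of ℝ⁵. -/
def A4latSubgroup : AddSubgroup (Fin 5 → ℝ) where
  carrier := A4lat
  zero_mem' := ⟨fun _ => ⟨0, by simp⟩, by simp⟩
  add_mem' := by
    rintro a b ⟨ha, ha'⟩ ⟨hb, hb'⟩
    refine ⟨fun i => ?_, by simp [Finset.sum_add_distrib, ha', hb']⟩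
    obtain ⟨m, hm⟩ := ha i
    obtain ⟨n, hn⟩ := hb i
    exact ⟨m + n, by simp [hm, hn]⟩
  neg_mem' := by
    rintro a ⟨ha, ha'⟩
    refine ⟨fun i => ?_, by simp [ha']⟩
    obtain ⟨m, hm⟩ := ha i
    exact ⟨-m, by simp [hm]⟩

/-- The dual lattice A₄* as a subgroup of ℝ⁵. -/
def A4dualSubgroup : AddSubgroup (Fin 5 → ℝ) where
  carrier := A4dual
  zero_mem' := ⟨by simp, fun _ _ => ⟨0, by simp [ip5]⟩⟩
  add_mem' := by
    rintro x y ⟨hx, hx'⟩ ⟨hy, hy'⟩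
    refine ⟨by simp [Finset.sum_add_distrib, hx, hy], fun a ha => ?_⟩
    obtain ⟨m, hm⟩ := hx' a ha
    obtain ⟨n, hn⟩ := hy' a ha
    refine ⟨m + n, ?_⟩
    rw [Int.cast_add, ← hm, ← hn]
    simp [ip5, add_mul, Finset.sum_add_distrib]
  neg_mem' := by
    rintro x ⟨hx, hx'⟩
    refine ⟨by simp [hx], fun a ha => ?_⟩
    obtain ⟨m, hm⟩ := hx' a ha
    refine ⟨-m, ?_⟩
    rw [Int.cast_neg, ← hm]
    simp [ip5]

theorem mem_A4latSubgroup {a : Fin 5 → ℝ} : a ∈ A4latSubgroup ↔ a ∈ A4lat := Iff.rfl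

theorem mem_A4dualSubgroup {a : Fin 5 → ℝ} : a ∈ A4dualSubgroup ↔ a ∈ A4dual := Iff.rfl

theorem A4lat_subset_A4dual : A4lat ⊆ A4dual := by
  rintro a ⟨ha, ha'⟩
  refine ⟨ha', fun b hb => ?_⟩
  choose m hm using ha
  choose n hn using hb.1
  exact ⟨∑ i, m i * n i, by simp [ip5, hm, hn]⟩

theorem w1_mem_A4dual : w1 ∈ A4dual := by
  refine ⟨by simp [w1, Fin.sum_univ_five]; norm_num, fun a ha => ?_⟩
  obtain ⟨n, hn⟩ := ha.1 0
  refine ⟨n, ?_⟩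
  have h := ha.2
  simp only [Fin.sum_univ_five] at h
  simp [ip5, w1, Fin.sum_univ_five, ← hn]
  linarith

theorem w1_add_w4_mem_A4lat : w1 + w4 ∈ A4lat := by
  have h : w1 + w4 = ![1, 0, 0, 0, -1] := by
    ext i
    fin_cases i <;> simp [w1, w4] <;> norm_num
  rw [h]
  refine ⟨fun i => ⟨(![1, 0, 0, 0, -1] : Fin 5 → ℤ) i, ?_⟩, by simp [Fin.sum_univ_five]⟩
  fin_cases i <;> simp

/-- A vector of A₄* is congruent to an integer multiple of `w1` modulo A₄. -/
theorem exists_sub_zsmul_w1_mem_A4lat {a : Fin 5 → ℝ} (ha : a ∈ A4dual) :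
    ∃ k : ℤ, a - k • w1 ∈ A4lat := by
  have hdiff : ∀ i, ∃ n : ℤ, a i - a 4 = n := fun i => by
    have hmem : (Pi.single i 1 - Pi.single 4 1 : Fin 5 → ℝ) ∈ A4lat := by
      refine ⟨fun j => ⟨(Pi.single i 1 - Pi.single 4 1 : Fin 5 → ℤ) j, ?_⟩, by simp⟩
      simp [Pi.single_apply]
    obtain ⟨n, hn⟩ := ha.2 _ hmem
    exact ⟨n, by simpa [ip5, mul_sub, Finset.sum_sub_distrib, Pi.single_apply] using hn⟩
  choose n hn using hdiff
  have hsum := ha.1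
  have hw := w1_mem_A4dual.1
  refine ⟨∑ i, n i, fun i => ?_, by simp [← Finset.mul_sum, hsum, hw]⟩
  have h4 : a 4 = -(∑ i, (n i : ℝ)) / 5 := by
    simp only [← hn, Fin.sum_univ_five] at hsum ⊢
    linarith
  have hi := hn i
  refine ⟨n i - if i = 0 then ∑ i, n i else 0, ?_⟩
  have hw1 : w1 i = (if i = 0 then 1 else 0) - 1 / 5 := by
    fin_cases i <;> simp [w1]; norm_num
  have hai : a i = n i - (∑ i, (n i : ℝ)) / 5 := by linarith
  rw [Pi.sub_apply, Pi.smul_apply, zsmul_eq_mul, hw1, hai]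
  split_ifs <;> push_cast <;> ring

/-- The first block of a vector of `N` lies in A₄*, and its other blocks sum to a vector of A₄. -/
theorem NLat_blocks {x : Fin 6 → Fin 5 → ℝ} (hx : x ∈ NLat) :
    x 0 ∈ A4dualSubgroup ∧ x 1 + x 2 + x 3 + x 4 + x 5 ∈ A4latSubgroup := by
  induction hx using AddSubgroup.closure_induction with
  | mem x hx =>
    rcases hx with hx | hx
    · have hx : ∀ k, x k ∈ A4latSubgroup := hx
      exact ⟨A4lat_subset_A4dual (hx 0), add_mem (add_mem (add_mem (add_mem
        (hx 1) (hx 2)) (hx 3)) (hx 4)) (hx 5)⟩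
    · have h : (w1 + w4) + (w1 + w4) ∈ A4latSubgroup :=
        add_mem w1_add_w4_mem_A4lat w1_add_w4_mem_A4lat
      rcases hx with rfl | rfl | rfl | rfl <;> refine ⟨w1_mem_A4dual, ?_⟩ <;>
        convert h using 1 <;> simp <;> abel
  | zero => simp [zero_mem]
  | add x y _ _ hx hy =>
    refine ⟨add_mem hx.1 hy.1, ?_⟩
    convert add_mem hx.2 hy.2 using 1
    simp only [Pi.add_apply]
    abel
  | neg x _ hx =>
    refine ⟨neg_mem hx.1, ?_⟩
    convert neg_mem hx.2 using 1
    simp only [Pi.neg_apply]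
    abel

theorem exists_mem_NLat_of_blocks {a b : Fin 5 → ℝ} (ha : a ∈ A4dual) (hb : b ∈ A4lat) :
    ∃ x ∈ NLat, x 0 = a ∧ x 1 + x 2 + x 3 + x 4 + x 5 = b := by
  obtain ⟨k, hk⟩ := exists_sub_zsmul_w1_mem_A4lat ha
  have hs : b - k • ((w1 + w4) + (w1 + w4)) ∈ A4latSubgroup :=
    sub_mem hb (zsmul_mem (add_mem w1_add_w4_mem_A4lat w1_add_w4_mem_A4lat) k)
  have h0 : (0 : Fin 5 → ℝ) ∈ A4lat := A4latSubgroup.zero_mem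
  have hroot : ![a - k • w1, b - k • ((w1 + w4) + (w1 + w4)), 0, 0, 0, 0] ∈ A4six := by
    intro i
    fin_cases i
    exacts [hk, hs, h0, h0, h0, h0]
  have hglue : ![w1, 0, w1, w4, w4, w1] ∈ glue := Or.inl rfl
  have hmem := NLat.add_mem (AddSubgroup.subset_closure (Or.inl hroot))
    (NLat.zsmul_mem (AddSubgroup.subset_closure (Or.inr hglue)) k)
  refine ⟨_, hmem, ?_, ?_⟩
  · simp only [Pi.add_apply, Pi.smul_apply, Matrix.cons_val]
    abel
  · simp only [Pi.add_apply, Pi.smul_apply, Matrix.cons_val, smul_add, smul_zero]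
    abel

theorem stmt_11 :
    P0 '' (NLat : Set (Fin 6 → Fin 5 → ℝ)) =
      {y | ∃ a ∈ A4dual, ∃ b ∈ A4lat,
        y = ![a, (1 / 5 : ℝ) • b, (1 / 5 : ℝ) • b, (1 / 5 : ℝ) • b,
              (1 / 5 : ℝ) • b, (1 / 5 : ℝ) • b]} := by
  ext y
  constructor
  · rintro ⟨x, hx, rfl⟩
    obtain ⟨ha, hb⟩ := NLat_blocks hx
    exact ⟨_, ha, _, hb, rfl⟩
  · rintro ⟨a, ha, b, hb, rfl⟩
    obtain ⟨x, hx, rfl, rfl⟩ := exists_mem_NLat_of_blocks ha hb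
    exact ⟨x, hx, rfl⟩
end

section
/- Let Λ' = (1,−1,0,−1,1) ∈ A₄ and Λ = (1/5)(1,1,1,1,−4) ∈ A₄*, and set v = (Λ', Λ, Λ, Λ, Λ, Λ) ∈ ℝ³⁰ and h = v/2. Then: (i) v ∈ N; (ii) (h|h) = 2; and (iii) for every α ∈ N, (α + h | α + h) > 1. -/
/-- The standard inner product on ℝ³⁰ = (ℝ⁵)⁶. -/
def ip30 (x y : Fin 6 → Fin 5 → ℝ) : ℝ := ∑ k, ip5 (x k) (y k)

/-- Λ' = (1,−1,0,−1,1) ∈ A₄. -/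
noncomputable def Λ' : Fin 5 → ℝ := ![1, -1, 0, -1, 1]

/-- Λ = (1/5)(1,1,1,1,−4) ∈ A₄* (equal to the glue weight w₄). -/
noncomputable def Λ : Fin 5 → ℝ := w4

/-- v = (Λ', Λ, Λ, Λ, Λ, Λ) ∈ ℝ³⁰. -/
noncomputable def v : Fin 6 → Fin 5 → ℝ := ![Λ', Λ, Λ, Λ, Λ, Λ]

/-- h = v/2. -/
noncomputable def h : Fin 6 → Fin 5 → ℝ := (1 / 2 : ℝ) • v

/-- A vector of `ℝ⁵` lies in `A4lat` as soon as it comes from an integer vector of sum zero. -/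
lemma intCast_mem_A4lat {n : Fin 5 → ℤ} (hn : ∑ i, n i = 0) :
    (fun i => (n i : ℝ)) ∈ A4lat :=
  ⟨fun i => ⟨n i, rfl⟩, by simpa using congrArg (Int.cast : ℤ → ℝ) hn⟩

lemma v_mem_NLat : v ∈ NLat := by
  let n : Fin 6 → Fin 5 → ℤ := ![![1, -1, 0, -1, 1], ![1, 0, 0, 0, -1], 0, 0,
    ![1, 0, 0, 0, -1], ![-1, 1, 1, 1, -2]]
  have hroot : (fun k i => (n k i : ℝ)) ∈ NLat := by
    refine AddSubgroup.subset_closure (Or.inl fun k => intCast_mem_A4lat ?_)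
    revert k
    decide
  have hglue {g : Fin 6 → Fin 5 → ℝ} (hg : g ∈ glue) : g ∈ NLat :=
    AddSubgroup.subset_closure (Or.inr hg)
  have hv : v = ![w1, 0, w1, w4, w4, w1] - ![w1, w1, 0, w1, w4, w4]
      - ![w1, w4, w1, 0, w1, w4] + ![w1, w4, w4, w1, 0, w1] + fun k i => (n k i : ℝ) := by
    funext k i
    fin_cases k <;> fin_cases i <;> norm_num [v, Λ, Λ', w1, w4, n]
  rw [hv]
  refine NLat.add_mem (NLat.add_mem (NLat.sub_mem (NLat.sub_mem ?_ ?_) ?_) ?_) hroot <;>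
    exact hglue (by simp [glue])

/-- Within each block, the coordinates of a vector of `NLat` lie in a common coset of `ℤ` in
`(1/5)ℤ`. -/
lemma exists_int_of_mem_NLat {α : Fin 6 → Fin 5 → ℝ} (hα : α ∈ NLat) (k : Fin 6) :
    ∃ (r : ℤ) (n : Fin 5 → ℤ), ∀ i, α k i = n i + r / 5 := by
  induction hα using AddSubgroup.closure_induction with
  | mem x hx =>
    rcases hx with hx | hx
    · choose n hn using (hx k).1
      exact ⟨0, n, fun i => by simp [hn]⟩
    · have hk : x k = 0 ∨ x k = w1 ∨ x k = w4 := by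
        rcases hx with rfl | rfl | rfl | rfl <;> fin_cases k <;> simp
      rcases hk with hk | hk | hk <;> rw [hk]
      · exact ⟨0, 0, fun i => by simp⟩
      · refine ⟨-1, ![1, 0, 0, 0, 0], fun i => ?_⟩
        fin_cases i <;> norm_num [w1]
      · refine ⟨1, ![0, 0, 0, 0, -1], fun i => ?_⟩
        fin_cases i <;> norm_num [w4]
  | zero => exact ⟨0, 0, fun i => by simp⟩
  | add x y _ _ hx hy =>
    obtain ⟨r, n, hn⟩ := hx
    obtain ⟨s, m, hm⟩ := hy
    refine ⟨r + s, n + m, fun i => ?_⟩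
    simp only [Pi.add_apply, hn, hm]
    push_cast
    ring
  | neg x _ hx =>
    obtain ⟨r, n, hn⟩ := hx
    refine ⟨-r, -n, fun i => ?_⟩
    simp only [Pi.neg_apply, hn]
    push_cast
    ring

lemma four_mul_sq_add_sq_ge {x y : ℤ} (hx : x % 2 = 1) (hy : y % 2 = 0)
    (hxy : x % 5 = y % 5) : 20 ≤ 4 * x ^ 2 + y ^ 2 := by
  by_contra! hlt
  have hx1 : x ≤ 2 := by nlinarith
  have hx2 : -2 ≤ x := by nlinarith
  have hy1 : y ≤ 4 := by nlinarith
  have hy2 : -4 ≤ y := by nlinarith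
  interval_cases x <;> interval_cases y <;> omega

/-- An integer vector in `ℤ⁵` whose coordinates are congruent modulo `5`, exactly one of them
being even, has norm at least `20`. -/
lemma sum_sq_ge {x : Fin 5 → ℤ} (j : Fin 5) (hj : x j % 2 = 0)
    (hodd : ∀ i ≠ j, x i % 2 = 1) (hmod : ∀ i, x i % 5 = x j % 5) :
    20 ≤ ∑ i, x i ^ 2 := by
  have hsum := Finset.sum_le_sum fun i (hi : i ∈ Finset.univ.erase j) =>
    four_mul_sq_add_sq_ge (hodd i (Finset.ne_of_mem_erase hi)) hj (hmod i)
  rw [Finset.sum_add_distrib, ← Finset.mul_sum] at hsum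
  simp only [Finset.sum_const, Finset.card_erase_of_mem (Finset.mem_univ j), Finset.card_univ,
    Fintype.card_fin, nsmul_eq_mul] at hsum
  push_cast at hsum
  rw [← Finset.add_sum_erase _ _ (Finset.mem_univ j)]
  linarith

/-- Each block of a vector of `NLat + h` has norm at least `1/5`. -/
lemma ip5_add_h_ge {α : Fin 6 → Fin 5 → ℝ} (hα : α ∈ NLat) (k : Fin 6) :
    1 / 5 ≤ ip5 ((α + h) k) ((α + h) k) := by
  obtain ⟨r, n, hn⟩ := exists_int_of_mem_NLat hα k
  obtain ⟨p, j, hp, hj, hodd, hmod⟩ : ∃ (p : Fin 5 → ℤ) (j : Fin 5),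
      (∀ i, v k i = p i / 5) ∧ p j % 2 = 0 ∧ (∀ i ≠ j, p i % 2 = 1) ∧
        ∀ i, p i % 5 = p j % 5 := by
    by_cases hk : k = 0
    · subst hk
      refine ⟨![5, -5, 0, -5, 5], 2, fun i => ?_, by decide, by decide, by decide⟩
      fin_cases i <;> norm_num [v, Λ']
    · have hv : v k = w4 := by
        fin_cases k <;> simp_all [v, Λ]
      refine ⟨![1, 1, 1, 1, -4], 4, fun i => ?_, by decide, by decide, by decide⟩
      rw [hv]
      fin_cases i <;> norm_num [w4]
  have hmain : 20 ≤ ∑ i, (10 * n i + 2 * r + p i) ^ 2 :=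
    sum_sq_ge j (by omega) (fun i hi => by have := hodd i hi; omega)
      (fun i => by have := hmod i; omega)
  have hcast : (20 : ℝ) ≤ ∑ i, (10 * (n i : ℝ) + 2 * r + p i) ^ 2 := by exact_mod_cast hmain
  have heq : ip5 ((α + h) k) ((α + h) k) =
      (1 / 100) * ∑ i, (10 * (n i : ℝ) + 2 * r + p i) ^ 2 := by
    rw [ip5, Finset.mul_sum]
    refine Finset.sum_congr rfl fun i _ => ?_
    simp only [h, Pi.add_apply, Pi.smul_apply, smul_eq_mul, hn, hp]
    ring
  rw [heq]
  linarith

theorem stmt_13 :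
    v ∈ NLat ∧
    ip30 h h = 2 ∧
    ∀ α : Fin 6 → Fin 5 → ℝ, α ∈ NLat → ip30 (α + h) (α + h) > 1 := by
  refine ⟨v_mem_NLat, ?_, fun α hα => ?_⟩
  · norm_num [ip30, ip5, h, v, Λ, Λ', w4, Fin.sum_univ_succ]
  · have hsum := Finset.sum_le_sum fun k (_ : k ∈ Finset.univ) => ip5_add_h_ge hα k
    rw [Finset.sum_const, Finset.card_univ, Fintype.card_fin] at hsum
    rw [ip30]
    norm_num at hsum ⊢
    linarith
end

section
/- Let λ = Σᵢ₌₁⁷ mᵢΛᵢ range over the dominant integral weights of E₇ with (λ|θ_{E₇}) ≤ 3 (mᵢ ∈ ℤ≥0), and let μ = Σᵢ₌₁⁵ nᵢΛ'ᵢ range over the dominant integral weights of A₅ with (μ|θ_{A₅}) ≤ 1 (nᵢ ∈ ℤ≥0, i.e., μ ∈ {0, Λ'₁, Λ'₂, Λ'₃, Λ'₄, Λ'₅}). Then (λ + 2ρ_{E₇} | λ)/42 + (μ + 2ρ_{A₅} | μ)/14 ∈ ℤ if and only if (λ, μ) is one of the eight pairs (0, 0), (Λ₂, Λ'₃), (Λ₆,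 Λ'₂), (Λ₆, Λ'₄), (Λ₁+Λ₇, Λ'₁), (Λ₁+Λ₇, Λ'₅), (Λ₂+Λ₇, 0), (3Λ₇, Λ'₃); moreover the value of the sum is 0, 2, 2, 2, 2, 2, 2, 3 respectively. -/
open RealInnerProductSpace

/-- Gram matrix of the simple roots of `E₇` (0-indexed), normalized so that
all roots have squared norm `2`. -/
def E7Gram (i j : Fin 7) : ℝ :=
  if i = j then 2
  else if (i, j) ∈ ([((0 : Fin 7), (2 : Fin 7)), (2, 0), (2, 3), (3, 2), (3, 4), (4, 3),
      (4, 5), (5, 4), (5, 6), (6, 5), (1, 3), (3, 1)] : List (Fin 7 × Fin 7)) then -1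
  else 0

/-- Gram matrix of the simple roots of `A₅` (0-indexed). -/
def A5Gram (i j : Fin 5) : ℝ :=
  if i = j then 2
  else if i.val + 1 = j.val ∨ j.val + 1 = i.val then -1
  else 0

section DualBasis

variable {ι V : Type*} [NormedAddCommGroup V] [InnerProductSpace ℝ V]

theorem eq_of_inner_eq_of_mem_span {α : ι → V} {v w : V}
    (hv : v ∈ Submodule.span ℝ (Set.range α)) (hw : w ∈ Submodule.span ℝ (Set.range α))
    (h : ∀ i, ⟪v, α i⟫ = ⟪w, α i⟫) : v = w := by
  have key : ∀ u ∈ Submodule.span ℝ (Set.range α), ⟪v - w, u⟫ = 0 := by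
    intro u hu
    induction hu using Submodule.span_induction with
    | mem x hx => obtain ⟨i, rfl⟩ := hx; rw [inner_sub_left, h, sub_self]
    | zero => exact inner_zero_right _
    | add x y _ _ hx hy => rw [inner_add_right, hx, hy, add_zero]
    | smul a x _ hx => rw [real_inner_smul_right, hx, mul_zero]
  exact sub_eq_zero.1 (inner_self_eq_zero.1 (key _ (Submodule.sub_mem _ hv hw)))

variable [Fintype ι]

/-- The vector with coordinates `c` in the fundamental weights `Λ`. -/
def weight (Λ : ι → V) (c : ι → ℕ) : V := ∑ i, c i • Λ i

/-- The value of `(λ + 2ρ | λ)` at `λ = ∑ i, c i • Λ i`, for `B` the Gram matrix of the `Λ i`. -/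
def casimir (B : Matrix ι ι ℤ) (c : ι → ℕ) : ℤ := ∑ i, ∑ j, (c i + 2) * c j * B i j

variable {α Λ : ι → V}

theorem mul_inner_weight_add_two_rho {B : Matrix ι ι ℤ} {d : ℤ}
    (hB : ∀ j k, d * ⟪Λ j, Λ k⟫ = B j k) (c : ι → ℕ) :
    d * ⟪weight Λ c + 2 • ∑ i, Λ i, weight Λ c⟫ = casimir B c := by
  have h : weight Λ c + 2 • ∑ i, Λ i = ∑ i, ((c i : ℝ) + 2) • Λ i := by
    simp [weight, Finset.smul_sum, ← Finset.sum_add_distrib, add_smul,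
      ← Nat.cast_smul_eq_nsmul ℝ]
  rw [h]
  simp only [weight, casimir, ← Nat.cast_smul_eq_nsmul ℝ, sum_inner, inner_sum,
    real_inner_smul_left, real_inner_smul_right, Finset.mul_sum, Int.cast_sum, Int.cast_mul,
    Int.cast_add, Int.cast_natCast, Int.cast_ofNat, ← hB]
  rw [Finset.sum_comm]
  exact Finset.sum_congr rfl fun i _ => Finset.sum_congr rfl fun j _ => by ring

variable [DecidableEq ι]

theorem inner_weight_root (hΛ : ∀ j i, ⟪Λ j, α i⟫ = if i = j then 1 else 0) (c : ι → ℕ) (i : ι) :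
    ⟪weight Λ c, α i⟫ = c i := by
  simp [weight, sum_inner, ← Nat.cast_smul_eq_nsmul ℝ, real_inner_smul_left, hΛ]

theorem weight_injective (hΛ : ∀ j i, ⟪Λ j, α i⟫ = if i = j then 1 else 0) :
    Function.Injective (weight Λ) := fun c d h => funext fun i => by
  have := inner_weight_root hΛ c i
  rw [h, inner_weight_root hΛ] at this
  exact_mod_cast this.symm

theorem mul_inner_dual {A B : Matrix ι ι ℤ} {d : ℤ} (hBA : B * A = d • (1 : Matrix ι ι ℤ))
    (hg : ∀ i j, ⟪α i, α j⟫ = A i j) (hΛmem : ∀ j, Λ j ∈ Submodule.span ℝ (Set.range α))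
    (hΛ : ∀ j i, ⟪Λ j, α i⟫ = if i = j then 1 else 0) (j k : ι) :
    d * ⟪Λ j, Λ k⟫ = B j k := by
  have expand : (d : ℝ) • Λ j = ∑ i, (B j i : ℝ) • α i := by
    refine eq_of_inner_eq_of_mem_span (Submodule.smul_mem _ _ (hΛmem j))
      (Submodule.sum_mem _ fun i _ => Submodule.smul_mem _ _
        (Submodule.subset_span (Set.mem_range_self i))) fun l => ?_
    have h : ((B * A) j l : ℝ) = ((d • (1 : Matrix ι ι ℤ)) j l : ℤ) := by rw [hBA]
    simp only [Matrix.mul_apply, Int.cast_sum, Int.cast_mul, Matrix.smul_apply,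
      Matrix.one_apply, smul_eq_mul, Int.cast_ite, Int.cast_one, Int.cast_zero] at h
    simp only [real_inner_smul_left, sum_inner, hg, hΛ, h, eq_comm]
  rw [← real_inner_smul_left, expand]
  simp [sum_inner, real_inner_smul_left, fun i => real_inner_comm (Λ k) (α i), hΛ]

end DualBasis

/-- The Cartan matrix of `E₇`. -/
def e7Cartan : Matrix (Fin 7) (Fin 7) ℤ :=
  !![2, 0, -1, 0, 0, 0, 0;
     0, 2, 0, -1, 0, 0, 0;
     -1, 0, 2, -1, 0, 0, 0;
     0, -1, -1, 2, -1, 0, 0;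
     0, 0, 0, -1, 2, -1, 0;
     0, 0, 0, 0, -1, 2, -1;
     0, 0, 0, 0, 0, -1, 2]

/-- Twice the inverse Cartan matrix of `E₇`. -/
def e7WeightGram : Matrix (Fin 7) (Fin 7) ℤ :=
  !![4, 4, 6, 8, 6, 4, 2;
     4, 7, 8, 12, 9, 6, 3;
     6, 8, 12, 16, 12, 8, 4;
     8, 12, 16, 24, 18, 12, 6;
     6, 9, 12, 18, 15, 10, 5;
     4, 6, 8, 12, 10, 8, 4;
     2, 3, 4, 6, 5, 4, 3]

/-- The Cartan matrix of `A₅`. -/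
def a5Cartan : Matrix (Fin 5) (Fin 5) ℤ :=
  !![2, -1, 0, 0, 0; -1, 2, -1, 0, 0; 0, -1, 2, -1, 0; 0, 0, -1, 2, -1; 0, 0, 0, -1, 2]

/-- Six times the inverse Cartan matrix of `A₅`. -/
def a5WeightGram : Matrix (Fin 5) (Fin 5) ℤ :=
  !![5, 4, 3, 2, 1; 4, 8, 6, 4, 2; 3, 6, 9, 6, 3; 2, 4, 6, 8, 4; 1, 2, 3, 4, 5]

theorem e7Gram_eq (i j : Fin 7) : E7Gram i j = e7Cartan i j := by
  have h : e7Cartan i j = if i = j then 2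
      else if (i, j) ∈ ([((0 : Fin 7), (2 : Fin 7)), (2, 0), (2, 3), (3, 2), (3, 4), (4, 3),
        (4, 5), (5, 4), (5, 6), (6, 5), (1, 3), (3, 1)] : List (Fin 7 × Fin 7)) then -1
      else 0 := by
    fin_cases i <;> fin_cases j <;> rfl
  rw [h, E7Gram]
  split_ifs <;> simp

theorem a5Gram_eq (i j : Fin 5) : A5Gram i j = a5Cartan i j := by
  have h : a5Cartan i j = if i = j then 2
      else if i.val + 1 = j.val ∨ j.val + 1 = i.val then -1 else 0 := by
    fin_cases i <;> fin_cases j <;> rfl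
  rw [h, A5Gram]
  split_ifs <;> simp

theorem e7WeightGram_mul_cartan :
    e7WeightGram * e7Cartan = (2 : ℤ) • (1 : Matrix (Fin 7) (Fin 7) ℤ) := by
  decide +kernel

theorem a5WeightGram_mul_cartan :
    a5WeightGram * a5Cartan = (6 : ℤ) • (1 : Matrix (Fin 5) (Fin 5) ℤ) := by
  decide +kernel

/-- The coordinates of the dominant weights of `E₇` of level at most `3`. -/
def e7LevelThree : List (Fin 7 → ℕ) :=
  [![0, 0, 0, 0, 0, 0, 0], ![0, 0, 0, 0, 0, 0, 1], ![0, 0, 0, 0, 0, 0, 2],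
    ![0, 0, 0, 0, 0, 0, 3], ![1, 0, 0, 0, 0, 0, 0], ![1, 0, 0, 0, 0, 0, 1],
    ![0, 1, 0, 0, 0, 0, 0], ![0, 1, 0, 0, 0, 0, 1], ![0, 0, 0, 0, 0, 1, 0],
    ![0, 0, 0, 0, 0, 1, 1], ![0, 0, 1, 0, 0, 0, 0], ![0, 0, 0, 0, 1, 0, 0]]

/-- The coordinates of the dominant weights of `A₅` of level at most `1`. -/
def a5LevelOne : List (Fin 5 → ℕ) :=
  [![0, 0, 0, 0, 0], ![1, 0, 0, 0, 0], ![0, 1, 0, 0, 0], ![0, 0, 1, 0, 0], ![0, 0, 0, 1, 0],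
    ![0, 0, 0, 0, 1]]

theorem mem_e7LevelThree (c : Fin 7 → ℕ)
    (h : 2 * c 0 + 2 * c 1 + 3 * c 2 + 4 * c 3 + 3 * c 4 + 2 * c 5 + c 6 ≤ 3) :
    c ∈ e7LevelThree := by
  have hc : c ∈ Fintype.piFinset fun i => Finset.range (![2, 2, 2, 1, 2, 2, 4] i) := by
    rw [Fintype.mem_piFinset]
    intro i
    fin_cases i <;> simp <;> omega
  revert c
  have : ∀ c ∈ Fintype.piFinset fun i => Finset.range (![2, 2, 2, 1, 2, 2, 4] i),
      2 * c 0 + 2 * c 1 + 3 * c 2 + 4 * c 3 + 3 * c 4 + 2 * c 5 + c 6 ≤ 3 →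
        c ∈ e7LevelThree := by decide +kernel
  exact fun c h hc => this c hc h

theorem mem_a5LevelOne (d : Fin 5 → ℕ) (h : d 0 + d 1 + d 2 + d 3 + d 4 ≤ 1) :
    d ∈ a5LevelOne := by
  have hd : d ∈ Fintype.piFinset fun _ => Finset.range 2 := by
    rw [Fintype.mem_piFinset]
    intro i
    fin_cases i <;> simp <;> omega
  revert d
  have : ∀ d ∈ Fintype.piFinset fun _ : Fin 5 => Finset.range 2,
      d 0 + d 1 + d 2 + d 3 + d 4 ≤ 1 → d ∈ a5LevelOne := by decide +kernel
  exact fun d h hd => this d hd h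

theorem dvd_casimir_add_casimir_iff : ∀ c ∈ e7LevelThree, ∀ d ∈ a5LevelOne,
    (84 ∣ casimir e7WeightGram c + casimir a5WeightGram d ↔
      (c = ![0, 0, 0, 0, 0, 0, 0] ∧ d = ![0, 0, 0, 0, 0]) ∨
      (c = ![0, 1, 0, 0, 0, 0, 0] ∧ d = ![0, 0, 1, 0, 0]) ∨
      (c = ![0, 0, 0, 0, 0, 1, 0] ∧ d = ![0, 1, 0, 0, 0]) ∨
      (c = ![0, 0, 0, 0, 0, 1, 0] ∧ d = ![0, 0, 0, 1, 0]) ∨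
      (c = ![1, 0, 0, 0, 0, 0, 1] ∧ d = ![1, 0, 0, 0, 0]) ∨
      (c = ![1, 0, 0, 0, 0, 0, 1] ∧ d = ![0, 0, 0, 0, 1]) ∨
      (c = ![0, 1, 0, 0, 0, 0, 1] ∧ d = ![0, 0, 0, 0, 0]) ∨
      (c = ![0, 0, 0, 0, 0, 0, 3] ∧ d = ![0, 0, 1, 0, 0])) := by
  decide +kernel

theorem stmt_14 {E F : Type*} [NormedAddCommGroup E] [InnerProductSpace ℝ E]
    [NormedAddCommGroup F] [InnerProductSpace ℝ F]
    (α : Fin 7 → E) (hα : LinearIndependent ℝ α)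
    (hg : ∀ i j, ⟪α i, α j⟫ = E7Gram i j)
    (Λ : Fin 7 → E) (hΛmem : ∀ j, Λ j ∈ Submodule.span ℝ (Set.range α))
    (hΛ : ∀ j i, ⟪Λ j, α i⟫ = if i = j then 1 else 0)
    (α' : Fin 5 → F) (hα' : LinearIndependent ℝ α')
    (hg' : ∀ i j, ⟪α' i, α' j⟫ = A5Gram i j)
    (Λ' : Fin 5 → F) (hΛ'mem : ∀ j, Λ' j ∈ Submodule.span ℝ (Set.range α'))
    (hΛ' : ∀ j i, ⟪Λ' j, α' i⟫ = if i = j then 1 else 0) :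
    -- ρ_{E₇} and ρ_{A₅}
    let ρ : E := ∑ i, Λ i
    let ρ' : F := ∑ i, Λ' i
    -- highest roots θ_{E₇} and θ_{A₅}
    let θ : E := 2 • α 0 + 2 • α 1 + 3 • α 2 + 4 • α 3 + 3 • α 4 + 2 • α 5 + α 6
    let θ' : F := α' 0 + α' 1 + α' 2 + α' 3 + α' 4
    -- sum of the conformal weights at levels 3 and 1
    let f : E → F → ℝ := fun l m => ⟪l + 2 • ρ, l⟫ / 42 + ⟪m + 2 • ρ', m⟫ / 14
    (∀ l : E, ∀ m : F,
      ((∃ c : Fin 7 → ℕ, l = ∑ i, c i • Λ i) ∧ ⟪l, θ⟫ ≤ 3) →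
      ((∃ c : Fin 5 → ℕ, m = ∑ i, c i • Λ' i) ∧ ⟪m, θ'⟫ ≤ 1) →
      ((∃ n : ℤ, f l m = n) ↔
        (l = 0 ∧ m = 0) ∨ (l = Λ 1 ∧ m = Λ' 2) ∨ (l = Λ 5 ∧ m = Λ' 1) ∨
        (l = Λ 5 ∧ m = Λ' 3) ∨ (l = Λ 0 + Λ 6 ∧ m = Λ' 0) ∨ (l = Λ 0 + Λ 6 ∧ m = Λ' 4) ∨
        (l = Λ 1 + Λ 6 ∧ m = 0) ∨ (l = 3 • Λ 6 ∧ m = Λ' 2))) ∧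
    f 0 0 = 0 ∧ f (Λ 1) (Λ' 2) = 2 ∧ f (Λ 5) (Λ' 1) = 2 ∧ f (Λ 5) (Λ' 3) = 2 ∧
    f (Λ 0 + Λ 6) (Λ' 0) = 2 ∧ f (Λ 0 + Λ 6) (Λ' 4) = 2 ∧ f (Λ 1 + Λ 6) 0 = 2 ∧
    f (3 • Λ 6) (Λ' 2) = 3 := by
  intro ρ ρ' θ θ' f
  have hE := mul_inner_dual e7WeightGram_mul_cartan
    (fun i j => (hg i j).trans (e7Gram_eq i j)) hΛmem hΛ
  have hA := mul_inner_dual a5WeightGram_mul_cartan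
    (fun i j => (hg' i j).trans (a5Gram_eq i j)) hΛ'mem hΛ'
  have hf (c : Fin 7 → ℕ) (d : Fin 5 → ℕ) : f (weight Λ c) (weight Λ' d) =
      (casimir e7WeightGram c + casimir a5WeightGram d : ℤ) / 84 := by
    have h₁ := mul_inner_weight_add_two_rho hE c
    have h₂ := mul_inner_weight_add_two_rho hA d
    push_cast at h₁ h₂ ⊢
    rw [← h₁, ← h₂]
    simp only [f, ρ, ρ']
    ring
  have e0 : (0 : E) = weight Λ ![0, 0, 0, 0, 0, 0, 0] := by simp [weight, Fin.sum_univ_succ]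
  have e1 : Λ 1 = weight Λ ![0, 1, 0, 0, 0, 0, 0] := by simp [weight, Fin.sum_univ_succ]
  have e5 : Λ 5 = weight Λ ![0, 0, 0, 0, 0, 1, 0] := by simp [weight, Fin.sum_univ_seven]
  have e06 : Λ 0 + Λ 6 = weight Λ ![1, 0, 0, 0, 0, 0, 1] := by
    simp [weight, Fin.sum_univ_seven]
  have e16 : Λ 1 + Λ 6 = weight Λ ![0, 1, 0, 0, 0, 0, 1] := by
    simp [weight, Fin.sum_univ_seven]
  have e666 : 3 • Λ 6 = weight Λ ![0, 0, 0, 0, 0, 0, 3] := by simp [weight, Fin.sum_univ_seven]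
  have a : (0 : F) = weight Λ' ![0, 0, 0, 0, 0] := by simp [weight, Fin.sum_univ_five]
  have a0 : Λ' 0 = weight Λ' ![1, 0, 0, 0, 0] := by simp [weight, Fin.sum_univ_five]
  have a1 : Λ' 1 = weight Λ' ![0, 1, 0, 0, 0] := by simp [weight, Fin.sum_univ_five]
  have a2 : Λ' 2 = weight Λ' ![0, 0, 1, 0, 0] := by simp [weight, Fin.sum_univ_five]
  have a3 : Λ' 3 = weight Λ' ![0, 0, 0, 1, 0] := by simp [weight, Fin.sum_univ_five]
  have a4 : Λ' 4 = weight Λ' ![0, 0, 0, 0, 1] := by simp [weight, Fin.sum_univ_five]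
  have value (c : Fin 7 → ℕ) (d : Fin 5 → ℕ) (n : ℤ)
      (h : casimir e7WeightGram c + casimir a5WeightGram d = 84 * n) :
      f (weight Λ c) (weight Λ' d) = n := by
    rw [hf, h]; push_cast; ring
  rw [e06, e16, e666, e1, e5, e0, a, a0, a1, a2, a3, a4]
  refine ⟨?_, by exact_mod_cast value _ _ 0 (by decide +kernel),
    by exact_mod_cast value _ _ 2 (by decide +kernel),
    by exact_mod_cast value _ _ 2 (by decide +kernel),
    by exact_mod_cast value _ _ 2 (by decide +kernel),
    by exact_mod_cast value _ _ 2 (by decide +kernel),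
    by exact_mod_cast value _ _ 2 (by decide +kernel),
    by exact_mod_cast value _ _ 2 (by decide +kernel),
    by exact_mod_cast value _ _ 3 (by decide +kernel)⟩
  rintro _ _ ⟨⟨c, rfl⟩, hc⟩ ⟨⟨d, rfl⟩, hd⟩
  change ⟪weight Λ c, θ⟫ ≤ 3 at hc
  change ⟪weight Λ' d, θ'⟫ ≤ 1 at hd
  change (∃ n : ℤ, f (weight Λ c) (weight Λ' d) = n) ↔
    (weight Λ c = _ ∧ weight Λ' d = _) ∨ (weight Λ c = _ ∧ weight Λ' d = _) ∨
    (weight Λ c = _ ∧ weight Λ' d = _) ∨ (weight Λ c = _ ∧ weight Λ' d = _) ∨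
    (weight Λ c = _ ∧ weight Λ' d = _) ∨ (weight Λ c = _ ∧ weight Λ' d = _) ∨
    (weight Λ c = _ ∧ weight Λ' d = _) ∨ (weight Λ c = _ ∧ weight Λ' d = _)
  simp only [θ, θ', inner_add_right, ← Nat.cast_smul_eq_nsmul ℝ, real_inner_smul_right,
    inner_weight_root hΛ, inner_weight_root hΛ'] at hc hd
  simp only [(weight_injective hΛ).eq_iff, (weight_injective hΛ').eq_iff]
  rw [← dvd_casimir_add_casimir_iff c (mem_e7LevelThree c (by exact_mod_cast hc))
    d (mem_a5LevelOne d (by exact_mod_cast hd)), hf]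
  refine exists_congr fun n => ?_
  rw [div_eq_iff (by norm_num), mul_comm]
  exact_mod_cast Iff.rfl
end

section
/- Let λ = Σᵢ₌₁⁶ mᵢΛᵢ range over the dominant integral weights of E₆ with (λ|θ_{E₆}) ≤ 3 (mᵢ ∈ ℤ≥0), and let μ₁, μ₂, μ₃ each range over {0, Λ^{G₂}₁} (the dominant integral weights of G₂ of level at most 1). Then (λ + 2ρ_{E₆} | λ)/30 + Σⱼ₌₁³ (μⱼ + 2ρ_{G₂} | μⱼ)/10 ∈ ℤ if and only if the tuple (λ; μ₁, μ₂, μ₃) is one of: (0; 0,0,0); (3Λ₁; 0,0,0); (3Λ₆; 0,0,0); (Λ₄; exactly one μⱼ equal to Λ^{G₂}₁ and the others 0); (Λ₁+Λ₆; exactly two μⱼ equal to Λ^{G₂}₁ and the other 0); (Λ₂; Λ^{G₂}₁, Λ^{G₂}₁, Λ^{G₂}₁); (Λ₁+Λ₃; Λ^{G₂}₁, Λ^{G₂}₁, Λ^{G₂}₁); (Λ₅+Λ₆; Λ^{G₂}₁, Λ^{G₂}₁, Λ^{G₂}₁). -/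
open RealInnerProductSpace

/-- Gram matrix of the simple roots of `E₆` (0-indexed), normalized so that
all roots have squared norm `2`. -/
def E6Gram (i j : Fin 6) : ℝ :=
  if i = j then 2
  else if (i, j) ∈ ([((0 : Fin 6), (2 : Fin 6)), (2, 0), (2, 3), (3, 2), (3, 4), (4, 3),
      (4, 5), (5, 4), (1, 3), (3, 1)] : List (Fin 6 × Fin 6)) then -1
  else 0

/-- Three times the inverse of the Cartan matrix of `E₆`. -/
def E6InvCartan : Matrix (Fin 6) (Fin 6) ℕ :=
  !![4, 3, 5, 6, 4, 2;
     3, 6, 6, 9, 6, 3;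
     5, 6, 10, 12, 8, 4;
     6, 9, 12, 18, 12, 6;
     4, 6, 8, 12, 10, 5;
     2, 3, 4, 6, 5, 4]

lemma sum_E6InvCartan_mul_E6Gram (i j : Fin 6) :
    ∑ k, (E6InvCartan j k : ℝ) / 3 * E6Gram k i = if i = j then 1 else 0 := by
  fin_cases i <;> fin_cases j <;>
    simp [Fin.sum_univ_six, E6InvCartan, E6Gram] <;> norm_num

section E6Weights

variable {E : Type*} [NormedAddCommGroup E] [InnerProductSpace ℝ E] {α Λ : Fin 6 → E}

lemma E6_fundamentalWeight_eq (hg : ∀ i j, ⟪α i, α j⟫ = E6Gram i j)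
    (hΛmem : ∀ j, Λ j ∈ Submodule.span ℝ (Set.range α))
    (hΛ : ∀ j i, ⟪Λ j, α i⟫ = if i = j then 1 else 0) (j : Fin 6) :
    Λ j = ∑ k, ((E6InvCartan j k : ℝ) / 3) • α k := by
  set w := ∑ k, ((E6InvCartan j k : ℝ) / 3) • α k with hw
  have hmem : Λ j - w ∈ Submodule.span ℝ (Set.range α) :=
    sub_mem (hΛmem j) (sum_mem fun k _ =>
      Submodule.smul_mem _ _ (Submodule.subset_span ⟨k, rfl⟩))
  have horth : Λ j - w ∈ (Submodule.span ℝ (Set.range α))ᗮ := by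
    rw [Submodule.mem_orthogonal']
    intro u hu
    induction hu using Submodule.span_induction with
    | mem x hx =>
      obtain ⟨i, rfl⟩ := hx
      rw [inner_sub_left, hΛ, hw, sum_inner]
      simp only [real_inner_smul_left, hg, sum_E6InvCartan_mul_E6Gram, sub_self]
    | zero => simp
    | add x y _ _ hx hy => rw [inner_add_right, hx, hy, add_zero]
    | smul a x _ hx => rw [real_inner_smul_right, hx, mul_zero]
  exact sub_eq_zero.mp (inner_self_eq_zero.mp
    (Submodule.inner_right_of_mem_orthogonal hmem horth))

lemma inner_E6_fundamentalWeight (hg : ∀ i j, ⟪α i, α j⟫ = E6Gram i j)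
    (hΛmem : ∀ j, Λ j ∈ Submodule.span ℝ (Set.range α))
    (hΛ : ∀ j i, ⟪Λ j, α i⟫ = if i = j then 1 else 0) (i j : Fin 6) :
    ⟪Λ i, Λ j⟫ = (E6InvCartan j i : ℝ) / 3 := by
  rw [E6_fundamentalWeight_eq hg hΛmem hΛ j, inner_sum]
  simp [real_inner_smul_right, hΛ]

lemma inner_sum_nsmul_E6_fundamentalWeight
    (hΛ : ∀ j i, ⟪Λ j, α i⟫ = if i = j then 1 else 0) (c : Fin 6 → ℕ) (i : Fin 6) :
    ⟪∑ j, c j • Λ j, α i⟫ = c i := by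
  simp [sum_inner, ← Nat.cast_smul_eq_nsmul ℝ, real_inner_smul_left, hΛ]

lemma sum_nsmul_E6_fundamentalWeight_inj
    (hΛ : ∀ j i, ⟪Λ j, α i⟫ = if i = j then 1 else 0) {c d : Fin 6 → ℕ} :
    ∑ j, c j • Λ j = ∑ j, d j • Λ j ↔ c = d := by
  refine ⟨fun h => funext fun i => ?_, fun h => h ▸ rfl⟩
  have := congrArg (fun x => ⟪x, α i⟫) h
  simpa only [inner_sum_nsmul_E6_fundamentalWeight hΛ, Nat.cast_inj] using this

/-- Three times `(λ + 2ρ | λ)` for the weight `λ` of `E₆` with coordinates `c`. -/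
def E6Casimir (c : Fin 6 → ℕ) : ℕ :=
  ∑ i, ∑ j, (c j + 2) * c i * E6InvCartan i j

lemma inner_add_two_rho_E6 (hg : ∀ i j, ⟪α i, α j⟫ = E6Gram i j)
    (hΛmem : ∀ j, Λ j ∈ Submodule.span ℝ (Set.range α))
    (hΛ : ∀ j i, ⟪Λ j, α i⟫ = if i = j then 1 else 0) (c : Fin 6 → ℕ) :
    ⟪∑ j, c j • Λ j + 2 • ∑ j, Λ j, ∑ j, c j • Λ j⟫ = (E6Casimir c : ℝ) / 3 := by
  rw [Finset.smul_sum, ← Finset.sum_add_distrib]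
  simp only [← add_smul, sum_inner, inner_sum, ← Nat.cast_smul_eq_nsmul ℝ,
    real_inner_smul_left, real_inner_smul_right, inner_E6_fundamentalWeight hg hΛmem hΛ]
  rw [E6Casimir]
  push_cast
  simp only [Finset.sum_div]
  exact Finset.sum_congr rfl fun i _ => Finset.sum_congr rfl fun j _ => by ring

end E6Weights

set_option synthInstance.maxSize 1000 in
lemma ninety_dvd_E6Casimir_add_iff (c : Fin 6 → ℕ)
    (hc : c 0 + 2 * c 1 + 2 * c 2 + 3 * c 3 + 2 * c 4 + c 5 ≤ 3) {k : ℕ} (hk : k ≤ 3) :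
    90 ∣ E6Casimir c + 36 * k ↔
      (k = 0 ∧ (c = ![0, 0, 0, 0, 0, 0] ∨ c = ![3, 0, 0, 0, 0, 0] ∨ c = ![0, 0, 0, 0, 0, 3])) ∨
      (k = 1 ∧ c = ![0, 0, 0, 1, 0, 0]) ∨
      (k = 2 ∧ c = ![1, 0, 0, 0, 0, 1]) ∨
      (k = 3 ∧ (c = ![0, 1, 0, 0, 0, 0] ∨ c = ![1, 0, 1, 0, 0, 0] ∨
        c = ![0, 0, 0, 0, 1, 1])) := by
  have key : ∀ c ∈ Fintype.piFinset fun i => Finset.range (![4, 2, 2, 2, 2, 4] i), ∀ k < 4,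
      c 0 + 2 * c 1 + 2 * c 2 + 3 * c 3 + 2 * c 4 + c 5 ≤ 3 →
      (90 ∣ E6Casimir c + 36 * k ↔
        (k = 0 ∧ (c = ![0, 0, 0, 0, 0, 0] ∨ c = ![3, 0, 0, 0, 0, 0] ∨
          c = ![0, 0, 0, 0, 0, 3])) ∨
        (k = 1 ∧ c = ![0, 0, 0, 1, 0, 0]) ∨
        (k = 2 ∧ c = ![1, 0, 0, 0, 0, 1]) ∨
        (k = 3 ∧ (c = ![0, 1, 0, 0, 0, 0] ∨ c = ![1, 0, 1, 0, 0, 0] ∨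
          c = ![0, 0, 0, 0, 1, 1]))) := by
    decide +kernel
  refine key c (Fintype.mem_piFinset.mpr fun i => Finset.mem_range.mpr ?_) k (by omega) hc
  fin_cases i <;> simp <;> omega

lemma exists_int_eq_iff_ninety_dvd (n k : ℕ) {x : ℝ} (hx : x = (n + 36 * k : ℕ) / 90) :
    (∃ z : ℤ, x = z) ↔ 90 ∣ n + 36 * k := by
  constructor
  · rintro ⟨z, hz⟩
    rw [hx, div_eq_iff (by norm_num)] at hz
    have : ((n + 36 * k : ℕ) : ℤ) = z * 90 := by exact_mod_cast hz
    omega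
  · rintro ⟨m, hm⟩
    refine ⟨m, ?_⟩
    rw [hx, hm]
    push_cast
    ring

theorem stmt_15 {E F : Type*} [NormedAddCommGroup E] [InnerProductSpace ℝ E]
    [NormedAddCommGroup F] [InnerProductSpace ℝ F]
    (α : Fin 6 → E) (hα : LinearIndependent ℝ α)
    (hg : ∀ i j, ⟪α i, α j⟫ = E6Gram i j)
    (Λ : Fin 6 → E) (hΛmem : ∀ j, Λ j ∈ Submodule.span ℝ (Set.range α))
    (hΛ : ∀ j i, ⟪Λ j, α i⟫ = if i = j then 1 else 0)
    -- G₂ simple roots a₁ (short), a₂ (long) with the normalized Killing form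
    (a1 a2 : F) (h11 : ⟪a1, a1⟫ = 2 / 3) (h22 : ⟪a2, a2⟫ = 2) (h12 : ⟪a1, a2⟫ = -1) :
    -- ρ_{E₆}
    let ρ : E := ∑ i, Λ i
    -- highest root θ_{E₆}
    let θ : E := α 0 + 2 • α 1 + 2 • α 2 + 3 • α 3 + 2 • α 4 + α 5
    -- the G₂ fundamental weights Λ^{G₂}₁, Λ^{G₂}₂ and ρ_{G₂}
    let L : F := 2 • a1 + a2
    let ρG : F := (2 • a1 + a2) + (3 • a1 + 2 • a2)
    -- sum of the conformal weights at levels 3,1,1,1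
    let f : E → F → F → F → ℝ := fun l m1 m2 m3 =>
      ⟪l + 2 • ρ, l⟫ / 30 + ⟪m1 + 2 • ρG, m1⟫ / 10 + ⟪m2 + 2 • ρG, m2⟫ / 10 +
        ⟪m3 + 2 • ρG, m3⟫ / 10
    ∀ l : E, ∀ m1 m2 m3 : F,
      ((∃ c : Fin 6 → ℕ, l = ∑ i, c i • Λ i) ∧ ⟪l, θ⟫ ≤ 3) →
      m1 ∈ ({0, L} : Set F) → m2 ∈ ({0, L} : Set F) → m3 ∈ ({0, L} : Set F) →
      ((∃ n : ℤ, f l m1 m2 m3 = n) ↔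
        (l = 0 ∧ m1 = 0 ∧ m2 = 0 ∧ m3 = 0) ∨
        (l = 3 • Λ 0 ∧ m1 = 0 ∧ m2 = 0 ∧ m3 = 0) ∨
        (l = 3 • Λ 5 ∧ m1 = 0 ∧ m2 = 0 ∧ m3 = 0) ∨
        (l = Λ 3 ∧ ((m1 = L ∧ m2 = 0 ∧ m3 = 0) ∨ (m1 = 0 ∧ m2 = L ∧ m3 = 0) ∨
          (m1 = 0 ∧ m2 = 0 ∧ m3 = L))) ∨
        (l = Λ 0 + Λ 5 ∧ ((m1 = L ∧ m2 = L ∧ m3 = 0) ∨ (m1 = L ∧ m2 = 0 ∧ m3 = L) ∨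
          (m1 = 0 ∧ m2 = L ∧ m3 = L))) ∨
        (l = Λ 1 ∧ m1 = L ∧ m2 = L ∧ m3 = L) ∨
        (l = Λ 0 + Λ 2 ∧ m1 = L ∧ m2 = L ∧ m3 = L) ∨
        (l = Λ 4 + Λ 5 ∧ m1 = L ∧ m2 = L ∧ m3 = L)) := by
  intro ρ θ L ρG f l m1 m2 m3 ⟨⟨c, hl⟩, hθ⟩ h1 h2 h3
  have h21 : ⟪a2, a1⟫ = -1 := by rw [real_inner_comm, h12]
  have hLval : ⟪L + 2 • ρG, L⟫ = 4 := by
    simp only [L, ρG, ← Nat.cast_smul_eq_nsmul ℝ, inner_add_left, inner_add_right,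
      real_inner_smul_left, real_inner_smul_right, h11, h22, h12, h21]
    norm_num
  have hL : L ≠ 0 := fun h => by
    rw [h, inner_zero_right] at hLval
    norm_num at hLval
  have hlevel : c 0 + 2 * c 1 + 2 * c 2 + 3 * c 3 + 2 * c 4 + c 5 ≤ 3 := by
    simp only [hl, θ, ← Nat.cast_smul_eq_nsmul ℝ 2, ← Nat.cast_smul_eq_nsmul ℝ 3,
      inner_add_right, real_inner_smul_right, inner_sum_nsmul_E6_fundamentalWeight hΛ] at hθ
    exact_mod_cast hθ
  have hval : ⟪l + 2 • ρ, l⟫ = (E6Casimir c : ℝ) / 3 := by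
    rw [hl]
    exact inner_add_two_rho_E6 hg hΛmem hΛ c
  have hf (k : ℕ) (hk : k ≤ 3)
      (hfk : f l m1 m2 m3 = (E6Casimir c : ℝ) / 3 / 30 + k * (4 / 10)) :=
    (exists_int_eq_iff_ninety_dvd (x := f l m1 m2 m3) (E6Casimir c) k (by rw [hfk]; push_cast; ring)).trans
      (ninety_dvd_E6Casimir_add_iff c hlevel hk)
  have hcoord (d : Fin 6 → ℕ) : c = d ↔ l = ∑ j, d j • Λ j := by
    rw [hl, sum_nsmul_E6_fundamentalWeight_inj hΛ]
  simp only [hcoord, Fin.sum_univ_six, Matrix.cons_val, zero_smul, one_smul, zero_add,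
    add_zero] at hf
  simp only [Set.mem_insert_iff, Set.mem_singleton_iff] at h1 h2 h3
  have hfdef : f l m1 m2 m3 = (E6Casimir c : ℝ) / 3 / 30 + ⟪m1 + 2 • ρG, m1⟫ / 10 +
      ⟪m2 + 2 • ρG, m2⟫ / 10 + ⟪m3 + 2 • ρG, m3⟫ / 10 := by
    rw [← hval]
  rcases h1 with rfl | rfl <;> rcases h2 with rfl | rfl <;> rcases h3 with rfl | rfl <;>
    simp only [inner_zero_right, hLval] at hfdef
  · rw [hf 0 (by norm_num) (by rw [hfdef]; norm_num)]
    simp [hL.symm]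
  · rw [hf 1 (by norm_num) (by rw [hfdef]; norm_num)]
    simp [hL, hL.symm]
  · rw [hf 1 (by norm_num) (by rw [hfdef]; norm_num)]
    simp [hL, hL.symm]
  · rw [hf 2 (by norm_num) (by rw [hfdef]; ring)]
    simp [hL, hL.symm]
  · rw [hf 1 (by norm_num) (by rw [hfdef]; norm_num)]
    simp [hL, hL.symm]
  · rw [hf 2 (by norm_num) (by rw [hfdef]; ring)]
    simp [hL, hL.symm]
  · rw [hf 2 (by norm_num) (by rw [hfdef]; ring)]
    simp [hL, hL.symm]
  · rw [hf 3 (by norm_num) (by rw [hfdef]; ring)]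
    simp [hL]
end

section
/- Let λ = Σᵢ₌₁⁷ mᵢΛᵢ range over the dominant integral weights of D₇ with (λ|θ_{D₇}) ≤ 3, let μ range over {0, Λ'₁, Λ'₂, Λ'₃} (the dominant weights of A₃ of level at most 1), and let ν range over {0, Λ^{G₂}₁} (the dominant weights of G₂ of level at most 1). Then (λ+2ρ_{D₇}|λ)/30 + (μ+2ρ_{A₃}|μ)/10 + (ν+2ρ_{G₂}|ν)/10 ∈ ℤ if and only if (λ, μ, ν) is one of the following (with j ∈ {6,7} and k ∈ {1,3}): (0, 0, 0); (Λ₃, Λ'₂, Λ^{G₂}₁); (Λ₅, Λ'₂, 0); (Λ₁+Λ₅, 0, 0); (3Λ₁, Λ'₂, 0); (Λ₁+Λⱼ, Λ'ₖ, Λ^{G₂}₁); (Λ₁+Λ₃, 0, Λ^{G₂}₁); (Λ₆+Λ₇, 0, Λ^{G₂}₁); (Λ₂+Λⱼ, Λ'ₖ, 0); (Λ₁+Λ₆+Λ₇, Λ'₂, Λ^{G₂}₁); (Λ₄+Λⱼ, Λ'ₖ, Λ^{G₂}₁); (3Λⱼ, Λ'ₖ, 0). Moreover the value of the sum is 0 for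 the first triple, 2 for the triples through (Λ₂+Λⱼ, Λ'ₖ, 0), and 3 for the last three families. -/
open RealInnerProductSpace

/-- Gram matrix of the simple roots of `D₇` (0-indexed): the first six simple
roots form a chain, the seventh is joined to the fifth. -/
def D7Gram (i j : Fin 7) : ℝ :=
  if i.val ≤ 5 ∧ j.val ≤ 5 then
    (if i = j then 2 else if i.val + 1 = j.val ∨ j.val + 1 = i.val then -1 else 0)
  else if i = j then 2
  else if (i = 6 ∧ j = 4) ∨ (i = 4 ∧ j = 6) then -1
  else 0

/-- Gram matrix of the simple roots of `A₃` (0-indexed). -/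
def A3Gram (i j : Fin 3) : ℝ :=
  if i = j then 2
  else if i.val + 1 = j.val ∨ j.val + 1 = i.val then -1
  else 0

section DualFamily

variable {V ι : Type*} [NormedAddCommGroup V] [InnerProductSpace ℝ V] [Fintype ι]

/-- A family in the span of `α` that is dual to `α` is obtained from `α` by the inverse of the
Gram matrix. Here the Gram matrix `M` is integral with inverse `B / d`. -/
theorem inner_dual_eq [DecidableEq ι] {α Λ : ι → V} {M : Matrix ι ι ℤ} {B : Matrix ι ι ℕ}
    {d : ℕ} (hd : d ≠ 0)
    (hg : ∀ i j, ⟪α i, α j⟫ = M i j)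
    (hmem : ∀ j, Λ j ∈ Submodule.span ℝ (Set.range α))
    (hΛ : ∀ j i, ⟪Λ j, α i⟫ = if i = j then 1 else 0)
    (hB : ∀ i j, ∑ k, (B i k : ℤ) * M k j = if j = i then (d : ℤ) else 0) (i j : ι) :
    ⟪Λ i, Λ j⟫ = (B j i : ℝ) / d := by
  have hd' : (d : ℝ) ≠ 0 := Nat.cast_ne_zero.mpr hd
  have hBR : ∀ i j, ∑ k, (B i k : ℝ) * M k j = if j = i then (d : ℝ) else 0 := fun i j => by
    exact_mod_cast congrArg (Int.cast : ℤ → ℝ) (hB i j)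
  set v : V := ∑ k, ((B j k : ℝ) / d) • α k with hv
  have hvα : ∀ i, ⟪v, α i⟫ = if i = j then 1 else 0 := fun i => by
    simp only [hv, sum_inner, real_inner_smul_left, hg, div_mul_eq_mul_div]
    rw [← Finset.sum_div, hBR]
    split_ifs <;> simp [hd']
  have hvmem : v ∈ Submodule.span ℝ (Set.range α) :=
    Submodule.sum_mem _ fun k _ => Submodule.smul_mem _ _ (Submodule.subset_span ⟨k, rfl⟩)
  have horth : ∀ x ∈ Submodule.span ℝ (Set.range α), ⟪Λ j - v, x⟫ = 0 := fun x hx => by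
    induction hx using Submodule.span_induction with
    | mem x hx =>
      obtain ⟨k, rfl⟩ := hx
      rw [inner_sub_left, hΛ, hvα, sub_self]
    | zero => exact inner_zero_right _
    | add x y _ _ hx hy => rw [inner_add_right, hx, hy, add_zero]
    | smul a x _ hx => rw [real_inner_smul_right, hx, mul_zero]
  have hΛv : Λ j = v :=
    sub_eq_zero.mp (inner_self_eq_zero.mp (horth _ (Submodule.sub_mem _ (hmem j) hvmem)))
  rw [hΛv, hv]
  simp [inner_sum, real_inner_smul_right, hΛ]

/-- The quadratic form `(c, c + 2)` of the matrix `B`, where `2` is the constant vector. -/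
def casimirForm (B : Matrix ι ι ℕ) (c : ι → ℕ) : ℕ :=
  ∑ i, ∑ j, c i * ((c j + 2) * B i j)

theorem inner_add_two_rho_eq {Λ : ι → V} {B : Matrix ι ι ℕ} {d : ℕ}
    (hB : ∀ i j, ⟪Λ i, Λ j⟫ = (B j i : ℝ) / d) (c : ι → ℕ) :
    ⟪∑ i, c i • Λ i + 2 • ∑ i, Λ i, ∑ i, c i • Λ i⟫ = (casimirForm B c : ℝ) / d := by
  have h : ∑ i, c i • Λ i + 2 • ∑ i, Λ i = ∑ i, (c i + 2) • Λ i := by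
    simp only [add_smul, Finset.sum_add_distrib, Finset.smul_sum]
  rw [h]
  simp only [casimirForm, ← Nat.cast_smul_eq_nsmul ℝ, sum_inner, inner_sum, real_inner_smul_left,
    real_inner_smul_right, hB, Nat.cast_sum, Nat.cast_mul, Finset.sum_div, mul_div_assoc]

theorem sum_nsmul_injective_of_dual [DecidableEq ι] {α Λ : ι → V}
    (hΛ : ∀ j i, ⟪Λ j, α i⟫ = if i = j then 1 else 0) :
    Function.Injective fun c : ι → ℕ => ∑ i, c i • Λ i := by
  have key : ∀ (c : ι → ℕ) (i : ι), ⟪∑ j, c j • Λ j, α i⟫ = c i := fun c i => by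
    simp [← Nat.cast_smul_eq_nsmul ℝ, sum_inner, real_inner_smul_left, hΛ]
  intro c c' h
  funext i
  have := congrArg (fun x => ⟪x, α i⟫) h
  simp only [key] at this
  exact_mod_cast this

end DualFamily

/-- Four times the inverse of the Cartan matrix of `D₇`. -/
def d7CartanInv : Matrix (Fin 7) (Fin 7) ℕ :=
  !![4, 4, 4, 4, 4, 2, 2;
     4, 8, 8, 8, 8, 4, 4;
     4, 8, 12, 12, 12, 6, 6;
     4, 8, 12, 16, 16, 8, 8;
     4, 8, 12, 16, 20, 10, 10;
     2, 4, 6, 8, 10, 7, 5;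
     2, 4, 6, 8, 10, 5, 7]

/-- Four times the inverse of the Cartan matrix of `A₃`. -/
def a3CartanInv : Matrix (Fin 3) (Fin 3) ℕ :=
  !![3, 2, 1; 2, 4, 2; 1, 2, 3]

theorem d7Gram_eq (i j : Fin 7) : D7Gram i j = (CartanMatrix.D 7 i j : ℤ) := by
  fin_cases i <;> fin_cases j <;> simp [D7Gram, CartanMatrix.D]

theorem a3Gram_eq (i j : Fin 3) : A3Gram i j = (CartanMatrix.A 3 i j : ℤ) := by
  fin_cases i <;> fin_cases j <;> simp [A3Gram, CartanMatrix.A]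

theorem d7CartanInv_mul (i j : Fin 7) :
    ∑ k, (d7CartanInv i k : ℤ) * CartanMatrix.D 7 k j = if j = i then ((4 : ℕ) : ℤ) else 0 := by
  revert i j; decide +kernel

theorem a3CartanInv_mul (i j : Fin 3) :
    ∑ k, (a3CartanInv i k : ℤ) * CartanMatrix.A 3 k j = if j = i then ((4 : ℕ) : ℤ) else 0 := by
  revert i j; decide +kernel

/-- `120` times the sum of the three conformal weights, in terms of coordinates with respect to
the fundamental weights. -/
def scaledWeight (c : Fin 7 → ℕ) (d : Fin 3 → ℕ) (e : ℕ) : ℕ :=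
  casimirForm d7CartanInv c + 3 * casimirForm a3CartanInv d + (8 * e ^ 2 + 40 * e)

/-- The list of triples of integral weight, in terms of coordinates with respect to the
fundamental weights. -/
def IsListed (c : Fin 7 → ℕ) (d : Fin 3 → ℕ) (e : ℕ) : Prop :=
  (c = 0 ∧ d = 0 ∧ e = 0) ∨
  (c = Pi.single 2 1 ∧ d = Pi.single 1 1 ∧ e = 1) ∨
  (c = Pi.single 4 1 ∧ d = Pi.single 1 1 ∧ e = 0) ∨
  (c = Pi.single 0 1 + Pi.single 4 1 ∧ d = 0 ∧ e = 0) ∨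
  (c = 3 • Pi.single 0 1 ∧ d = Pi.single 1 1 ∧ e = 0) ∨
  (∃ j ∈ ({5, 6} : Finset (Fin 7)), ∃ k ∈ ({0, 2} : Finset (Fin 3)),
    c = Pi.single 0 1 + Pi.single j 1 ∧ d = Pi.single k 1 ∧ e = 1) ∨
  (c = Pi.single 0 1 + Pi.single 2 1 ∧ d = 0 ∧ e = 1) ∨
  (c = Pi.single 5 1 + Pi.single 6 1 ∧ d = 0 ∧ e = 1) ∨
  (∃ j ∈ ({5, 6} : Finset (Fin 7)), ∃ k ∈ ({0, 2} : Finset (Fin 3)),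
    c = Pi.single 1 1 + Pi.single j 1 ∧ d = Pi.single k 1 ∧ e = 0) ∨
  (c = Pi.single 0 1 + Pi.single 5 1 + Pi.single 6 1 ∧ d = Pi.single 1 1 ∧ e = 1) ∨
  (∃ j ∈ ({5, 6} : Finset (Fin 7)), ∃ k ∈ ({0, 2} : Finset (Fin 3)),
    c = Pi.single 3 1 + Pi.single j 1 ∧ d = Pi.single k 1 ∧ e = 1) ∨
  (∃ j ∈ ({5, 6} : Finset (Fin 7)), ∃ k ∈ ({0, 2} : Finset (Fin 3)),
    c = 3 • Pi.single j 1 ∧ d = Pi.single k 1 ∧ e = 0)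

set_option synthInstance.maxSize 4096 in
set_option synthInstance.maxHeartbeats 400000 in
instance (c : Fin 7 → ℕ) (d : Fin 3 → ℕ) (e : ℕ) : Decidable (IsListed c d e) := by
  unfold IsListed; infer_instance

set_option synthInstance.maxSize 4096 in
set_option synthInstance.maxHeartbeats 400000 in
theorem dvd_scaledWeight_vec :
    ∀ c1 < 2, ∀ c2 < 2, ∀ c3 < 2, ∀ c4 < 2, ∀ c0 < 4, ∀ c5 < 4, ∀ c6 < 4,
      c0 + 2 * (c1 + c2 + c3 + c4) + c5 + c6 ≤ 3 →
      ∀ d ∈ ([0, Pi.single 0 1, Pi.single 1 1, Pi.single 2 1] : List (Fin 3 → ℕ)), ∀ e < 2,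
        (120 ∣ scaledWeight ![c0, c1, c2, c3, c4, c5, c6] d e ↔
          IsListed ![c0, c1, c2, c3, c4, c5, c6] d e) := by
  decide +kernel

theorem dvd_scaledWeight_iff {c : Fin 7 → ℕ} {d : Fin 3 → ℕ} {e : ℕ}
    (hc : c 0 + 2 * (c 1 + c 2 + c 3 + c 4) + c 5 + c 6 ≤ 3)
    (hd : d ∈ ([0, Pi.single 0 1, Pi.single 1 1, Pi.single 2 1] : List (Fin 3 → ℕ)))
    (he : e < 2) : 120 ∣ scaledWeight c d e ↔ IsListed c d e := by
  have h : c = ![c 0, c 1, c 2, c 3, c 4, c 5, c 6] := by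
    ext i; fin_cases i <;> rfl
  rw [h]
  exact dvd_scaledWeight_vec _ (by lia) _ (by lia) _ (by lia) _ (by lia) _ (by lia) _ (by lia)
    _ (by lia) hc d hd e he

theorem exists_int_eq_div_iff_dvd {n k : ℕ} (hk : k ≠ 0) :
    (∃ z : ℤ, (n : ℝ) / k = z) ↔ k ∣ n := by
  have hk' : (k : ℝ) ≠ 0 := Nat.cast_ne_zero.mpr hk
  rw [← Int.natCast_dvd_natCast]
  refine exists_congr fun z => ?_
  rw [div_eq_iff hk', mul_comm]
  exact_mod_cast Iff.rfl

theorem stmt_16 {E F G : Type*} [NormedAddCommGroup E] [InnerProductSpace ℝ E]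
    [NormedAddCommGroup F] [InnerProductSpace ℝ F]
    [NormedAddCommGroup G] [InnerProductSpace ℝ G]
    -- D₇ data
    (α : Fin 7 → E) (hα : LinearIndependent ℝ α)
    (hg : ∀ i j, ⟪α i, α j⟫ = D7Gram i j)
    (Λ : Fin 7 → E) (hΛmem : ∀ j, Λ j ∈ Submodule.span ℝ (Set.range α))
    (hΛ : ∀ j i, ⟪Λ j, α i⟫ = if i = j then 1 else 0)
    -- A₃ data
    (α' : Fin 3 → F) (hα' : LinearIndependent ℝ α')
    (hg' : ∀ i j, ⟪α' i, α' j⟫ = A3Gram i j)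
    (Λ' : Fin 3 → F) (hΛ'mem : ∀ j, Λ' j ∈ Submodule.span ℝ (Set.range α'))
    (hΛ' : ∀ j i, ⟪Λ' j, α' i⟫ = if i = j then 1 else 0)
    -- G₂ data
    (a1 a2 : G) (h11 : ⟪a1, a1⟫ = 2 / 3) (h22 : ⟪a2, a2⟫ = 2) (h12 : ⟪a1, a2⟫ = -1) :
    let ρ : E := ∑ i, Λ i
    let θ : E := α 0 + 2 • α 1 + 2 • α 2 + 2 • α 3 + 2 • α 4 + α 5 + α 6
    let ρ' : F := ∑ i, Λ' i
    let L : G := 2 • a1 + a2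
    let ρG : G := (2 • a1 + a2) + (3 • a1 + 2 • a2)
    -- sum of the conformal weights at levels 3, 1, 1
    let f : E → F → G → ℝ := fun l m n =>
      ⟪l + 2 • ρ, l⟫ / 30 + ⟪m + 2 • ρ', m⟫ / 10 + ⟪n + 2 • ρG, n⟫ / 10
    (∀ l : E, ∀ m : F, ∀ n : G,
      ((∃ c : Fin 7 → ℕ, l = ∑ i, c i • Λ i) ∧ ⟪l, θ⟫ ≤ 3) →
      m ∈ ({0, Λ' 0, Λ' 1, Λ' 2} : Set F) →
      n ∈ ({0, L} : Set G) →
      ((∃ z : ℤ, f l m n = z) ↔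
        (l = 0 ∧ m = 0 ∧ n = 0) ∨
        (l = Λ 2 ∧ m = Λ' 1 ∧ n = L) ∨
        (l = Λ 4 ∧ m = Λ' 1 ∧ n = 0) ∨
        (l = Λ 0 + Λ 4 ∧ m = 0 ∧ n = 0) ∨
        (l = 3 • Λ 0 ∧ m = Λ' 1 ∧ n = 0) ∨
        (∃ j ∈ ({5, 6} : Set (Fin 7)), ∃ k ∈ ({0, 2} : Set (Fin 3)),
          l = Λ 0 + Λ j ∧ m = Λ' k ∧ n = L) ∨
        (l = Λ 0 + Λ 2 ∧ m = 0 ∧ n = L) ∨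
        (l = Λ 5 + Λ 6 ∧ m = 0 ∧ n = L) ∨
        (∃ j ∈ ({5, 6} : Set (Fin 7)), ∃ k ∈ ({0, 2} : Set (Fin 3)),
          l = Λ 1 + Λ j ∧ m = Λ' k ∧ n = 0) ∨
        (l = Λ 0 + Λ 5 + Λ 6 ∧ m = Λ' 1 ∧ n = L) ∨
        (∃ j ∈ ({5, 6} : Set (Fin 7)), ∃ k ∈ ({0, 2} : Set (Fin 3)),
          l = Λ 3 + Λ j ∧ m = Λ' k ∧ n = L) ∨
        (∃ j ∈ ({5, 6} : Set (Fin 7)), ∃ k ∈ ({0, 2} : Set (Fin 3)),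
          l = 3 • Λ j ∧ m = Λ' k ∧ n = 0))) ∧
    -- the values of the sum on the listed triples
    f 0 0 0 = 0 ∧
    f (Λ 2) (Λ' 1) L = 2 ∧
    f (Λ 4) (Λ' 1) 0 = 2 ∧
    f (Λ 0 + Λ 4) 0 0 = 2 ∧
    f (3 • Λ 0) (Λ' 1) 0 = 2 ∧
    (∀ j ∈ ({5, 6} : Set (Fin 7)), ∀ k ∈ ({0, 2} : Set (Fin 3)),
      f (Λ 0 + Λ j) (Λ' k) L = 2) ∧
    f (Λ 0 + Λ 2) 0 L = 2 ∧
    f (Λ 5 + Λ 6) 0 L = 2 ∧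
    (∀ j ∈ ({5, 6} : Set (Fin 7)), ∀ k ∈ ({0, 2} : Set (Fin 3)),
      f (Λ 1 + Λ j) (Λ' k) 0 = 2) ∧
    f (Λ 0 + Λ 5 + Λ 6) (Λ' 1) L = 3 ∧
    (∀ j ∈ ({5, 6} : Set (Fin 7)), ∀ k ∈ ({0, 2} : Set (Fin 3)),
      f (Λ 3 + Λ j) (Λ' k) L = 3) ∧
    (∀ j ∈ ({5, 6} : Set (Fin 7)), ∀ k ∈ ({0, 2} : Set (Fin 3)),
      f (3 • Λ j) (Λ' k) 0 = 3) := by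
  intro ρ θ ρ' L ρG f
  have hD := inner_dual_eq (B := d7CartanInv) four_ne_zero
    (fun i j => (hg i j).trans (d7Gram_eq i j)) hΛmem hΛ d7CartanInv_mul
  have hA := inner_dual_eq (B := a3CartanInv) four_ne_zero
    (fun i j => (hg' i j).trans (a3Gram_eq i j)) hΛ'mem hΛ' a3CartanInv_mul
  have hG : ∀ e : ℕ, ⟪e • L + 2 • ρG, e • L⟫ = (2 * e ^ 2 + 10 * e : ℝ) / 3 := fun e => by
    have h21 : ⟪a2, a1⟫ = -1 := real_inner_comm a1 a2 ▸ h12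
    simp only [L, ρG, ← Nat.cast_smul_eq_nsmul ℝ, inner_add_left, inner_add_right,
      real_inner_smul_left, real_inner_smul_right, h11, h22, h12, h21]
    push_cast
    ring
  let w : (Fin 7 → ℕ) → E := fun c => ∑ i, c i • Λ i
  let w' : (Fin 3 → ℕ) → F := fun d => ∑ i, d i • Λ' i
  let u : ℕ → G := fun e => e • L
  have hw : Function.Injective w := sum_nsmul_injective_of_dual hΛ
  have hw' : Function.Injective w' := sum_nsmul_injective_of_dual hΛ'
  have hL : L ≠ 0 := fun h => by
    have := hG 1
    rw [h, smul_zero, inner_zero_right] at this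
    norm_num at this
  have hu : Function.Injective u := fun a b h => by
    have h' : (a : ℝ) • L = (b : ℝ) • L := by simpa only [Nat.cast_smul_eq_nsmul] using h
    exact_mod_cast smul_left_injective ℝ hL h'
  have w_zero : w 0 = 0 := by simp [w]
  have w_single : ∀ i, w (Pi.single i 1) = Λ i := fun i => by
    simp [w]
  have w_add : ∀ c c', w (c + c') = w c + w c' := fun c c' => by
    simp [w, add_smul, Finset.sum_add_distrib]
  have w_smul : ∀ (k : ℕ) c, w (k • c) = k • w c := fun k c => by
    simp [w, mul_smul, Finset.smul_sum]
  have w'_zero : w' 0 = 0 := by simp [w']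
  have w'_single : ∀ i, w' (Pi.single i 1) = Λ' i := fun i => by
    simp [w']
  have u_zero : u 0 = 0 := zero_smul _ _
  have u_one : u 1 = L := one_smul _ _
  have hf : ∀ c d e, f (w c) (w' d) (u e) = (scaledWeight c d e : ℝ) / (120 : ℕ) :=
    fun c d e => by
      simp only [f, w, w', u, ρ, ρ', inner_add_two_rho_eq hD, inner_add_two_rho_eq hA, hG,
        scaledWeight]
      push_cast
      ring
  have hval : ∀ (k : ℕ) c d e, scaledWeight c d e = 120 * k → f (w c) (w' d) (u e) = k :=
    fun k c d e h => by
      rw [hf, h]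
      push_cast
      ring
  refine ⟨?_, ?_⟩
  · rintro l m n ⟨⟨c, hl⟩, hc⟩ hm hn
    obtain rfl : w c = l := hl.symm
    have hlevel : c 0 + 2 * (c 1 + c 2 + c 3 + c 4) + c 5 + c 6 ≤ 3 := by
      have hα : ∀ i, ⟪w c, α i⟫ = c i := fun i => by
        simp [w, ← Nat.cast_smul_eq_nsmul ℝ, sum_inner, real_inner_smul_left, hΛ]
      simp only [θ, ← Nat.cast_smul_eq_nsmul ℝ, inner_add_right, real_inner_smul_right, hα] at hc
      have : ((c 0 + 2 * (c 1 + c 2 + c 3 + c 4) + c 5 + c 6 : ℕ) : ℝ) ≤ (3 : ℕ) := by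
        push_cast at hc ⊢
        linarith
      exact_mod_cast this
    obtain ⟨d, hd, rfl⟩ : ∃ d ∈ ([0, Pi.single 0 1, Pi.single 1 1, Pi.single 2 1] :
        List (Fin 3 → ℕ)), w' d = m := by
      simpa [w'_zero, w'_single, eq_comm] using hm
    obtain ⟨e, he, rfl⟩ : ∃ e < 2, u e = n := by
      rcases hn with rfl | rfl
      exacts [⟨0, by lia, u_zero⟩, ⟨1, by lia, u_one⟩]
    rw [hf, exists_int_eq_div_iff_dvd (by norm_num), dvd_scaledWeight_iff hlevel hd he]
    simp only [IsListed, ← hw.eq_iff, ← hw'.eq_iff, ← hu.eq_iff, w_add, w_smul, w_single, w_zero,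
      w'_single, w'_zero, u_zero, u_one, Finset.mem_insert, Finset.mem_singleton,
      Set.mem_insert_iff, Set.mem_singleton_iff]
  · simp only [← w_zero, ← w'_zero, ← u_zero, ← u_one, ← w_single, ← w'_single, ← w_add, ← w_smul]
    refine ⟨?_, ?_, ?_, ?_, ?_, ?_, ?_, ?_, ?_, ?_, ?_, ?_⟩
    · exact_mod_cast hval 0 _ _ _ (by decide +kernel)
    iterate 4 exact_mod_cast hval 2 _ _ _ (by decide +kernel)
    · rintro j (rfl | rfl) k (rfl | rfl) <;> exact_mod_cast hval 2 _ _ _ (by decide +kernel)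
    iterate 2 exact_mod_cast hval 2 _ _ _ (by decide +kernel)
    · rintro j (rfl | rfl) k (rfl | rfl) <;> exact_mod_cast hval 2 _ _ _ (by decide +kernel)
    · exact_mod_cast hval 3 _ _ _ (by decide +kernel)
    iterate 2
      rintro j (rfl | rfl) k (rfl | rfl) <;> exact_mod_cast hval 3 _ _ _ (by decide +kernel)
end
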